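/- Let I ⊂ K[x_1,x_2,x_3,x_4] be an ideal minimally generated by four quadrics such that the generic initial ideal of I with respect to the lexicographic order contains x_1^2, x_1x_2, x_1x_3, x_2^2. Then, up to a linear change of coordinates, [I]_2 is one of finitely many explicit 4-dimensional spaces of quadrics: (i) ⟨x_1x_3, x_1x_4, x_2x_3, x_2x_4⟩; (ii) ⟨x_1^2, x_2^2, x_3^2, x_1x_2+x_1x_3+x_2x_3⟩; (iii) ⟨x_1^2, x_2^2, x_3^2, x_1x_3+x_2x_3⟩; (iv) ⟨x_1^2, x_1x_2, x_1x_3−x_2^2, x_3^2⟩; (v) ⟨x_1^2, x_1x_2, x_1x_3−x_2^2, x_2x_3⟩; (vi) ⟨x_1^2, x_1x_3, x_2^2, x_2x_3⟩; (vii) ⟨x_1^2, x_1x_2, x_1x_3, x_2x_3⟩; (viii) ⟨x_1^2, x_1x_2, x_2^2, q⟩ with q ∈ {x_3x_4, x_3^2+x_2x_4, x_3^2}; (ix) ⟨x_1^2, x_1x_2, x_2^2, x_1x_4−x_2x_3⟩; (x) ⟨x_1^2, x_1x_2, x_2^2, x_1x_3⟩. -/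

import Mathlib

open MvPolynomial

noncomputable section

variable {K : Type*} [Field K] {n : ℕ}

/-- The degree `i` graded piece of the standard graded algebra `R/I`,
where `R = K[x_1,…,x_n]`. -/
def piece (I : Ideal (MvPolynomial (Fin n) K)) (i : ℕ) :
    Submodule K (MvPolynomial (Fin n) K ⧸ I) :=
  (homogeneousSubmodule (Fin n) K i).map (Ideal.Quotient.mkₐ K I).toLinearMap

/-- The Hilbert function of the standard graded algebra `R/I`. -/
def hf (I : Ideal (MvPolynomial (Fin n) K)) (i : ℕ) : ℕ :=
  Module.finrank K (piece I i)

/-- `I` is a homogeneous ideal. -/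
def IsHomogIdeal (I : Ideal (MvPolynomial (Fin n) K)) : Prop :=
  ∀ p ∈ I, ∀ i : ℕ, homogeneousComponent i p ∈ I

/-- The socle of `R/I`: the annihilator of the irrelevant maximal ideal. -/
def socle (I : Ideal (MvPolynomial (Fin n) K)) :
    Submodule K (MvPolynomial (Fin n) K ⧸ I) :=
  ⨅ j : Fin n, LinearMap.ker (LinearMap.mulLeft K (Ideal.Quotient.mk I (X j)))

/-- `R/I` is a standard graded artinian Gorenstein algebra of socle degree `d`:
`I` is homogeneous, the Hilbert function vanishes above degree `d`, is symmetric,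
and the socle is one-dimensional, concentrated in degree `d`. -/
def IsArtinianGorenstein (I : Ideal (MvPolynomial (Fin n) K)) (d : ℕ) : Prop :=
  IsHomogIdeal I ∧ hf I d = 1 ∧ (∀ i : ℕ, d < i → hf I i = 0) ∧
    (∀ i : ℕ, i ≤ d → hf I i = hf I (d - i)) ∧
    Module.finrank K (socle I) = 1 ∧ socle I ≤ piece I d

/-- The weak Lefschetz property for `R/I`: there is a linear form `ℓ` such that
multiplication `×ℓ : [A]_i → [A]_{i+1}` has maximal rank (is injective or
surjective) for every `i`. -/
def WLP (I : Ideal (MvPolynomial (Fin n) K)) : Prop :=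
  ∃ ℓ : MvPolynomial (Fin n) K, ℓ.IsHomogeneous 1 ∧ ∀ i : ℕ,
    (∀ a ∈ piece I i, Ideal.Quotient.mk I ℓ * a = 0 → a = 0) ∨
    (∀ b ∈ piece I (i + 1), ∃ a ∈ piece I i, Ideal.Quotient.mk I ℓ * a = b)

/-- The strong Lefschetz property for `R/I`: there is a linear form `ℓ` such that
`×ℓ^k : [A]_i → [A]_{i+k}` has maximal rank for all `i ≥ 0`, `k ≥ 1`. -/
def SLP (I : Ideal (MvPolynomial (Fin n) K)) : Prop :=
  ∃ ℓ : MvPolynomial (Fin n) K, ℓ.IsHomogeneous 1 ∧ ∀ i k : ℕ, 1 ≤ k →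
    ((∀ a ∈ piece I i, Ideal.Quotient.mk I ℓ ^ k * a = 0 → a = 0) ∨
     (∀ b ∈ piece I (i + k), ∃ a ∈ piece I i, Ideal.Quotient.mk I ℓ ^ k * a = b))

/-- The action of `p ∈ R = K[x_1,…,x_n]` on `S = K[X_1,…,X_n]` by differentiation,
`x_i` acting as `∂/∂X_i`. -/
def diffOp (p : MvPolynomial (Fin n) K) :
    Module.End K (MvPolynomial (Fin n) K) :=
  ∑ m ∈ p.support, MvPolynomial.coeff m p •
    (List.ofFn fun j : Fin n =>
      ((pderiv j).toLinearMap : Module.End K (MvPolynomial (Fin n) K)) ^ (m j)).prod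

/-- The degree-`d` graded piece of the inverse system `I^⊥ = {F : g ∘ F = 0 ∀ g ∈ I}`. -/
def invSys (I : Ideal (MvPolynomial (Fin n) K)) (d : ℕ) :
    Submodule K (MvPolynomial (Fin n) K) :=
  homogeneousSubmodule (Fin n) K d ⊓ ⨅ g ∈ I, LinearMap.ker (diffOp g)

end

noncomputable section

/-- Lexicographic order on exponent vectors with `x₁ > x₂ > x₃ > x₄`:
`a < b` iff at the first (most significant) index where they differ,
`a` has the smaller exponent. -/
def lexLT (a b : Fin 4 →₀ ℕ) : Prop :=
  ∃ i : Fin 4, (∀ j : Fin 4, j < i → a j = b j) ∧ a i < b i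

/-- `m` is the lex-leading monomial of the polynomial `q`. -/
def leadIs {K : Type*} [Field K] (q : MvPolynomial (Fin 4) K) (m : Fin 4 →₀ ℕ) : Prop :=
  MvPolynomial.coeff m q ≠ 0 ∧ ∀ m' : Fin 4 →₀ ℕ, lexLT m m' → MvPolynomial.coeff m' q = 0

/-- The linear change of coordinates on `K[x₁,…,x₄]` given by the matrix `g`. -/
def chg {K : Type*} [Field K] (g : Matrix (Fin 4) (Fin 4) K) :
    MvPolynomial (Fin 4) K →ₐ[K] MvPolynomial (Fin 4) K :=
  MvPolynomial.aeval fun i : Fin 4 => ∑ j : Fin 4, g i j • X j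

/-- The degree-2 graded piece `[I]₂` of an ideal, as a `K`-subspace of `R`. -/
def quadPart {K : Type*} [Field K] (I : Ideal (MvPolynomial (Fin 4) K)) :
    Submodule K (MvPolynomial (Fin 4) K) :=
  Submodule.restrictScalars K I ⊓ homogeneousSubmodule (Fin 4) K 2

section
abbrev PP (K : Type*) [Field K] := MvPolynomial (Fin 4) K

section base
variable {K : Type*} [Field K]

theorem chg_X (g : Matrix (Fin 4) (Fin 4) K) (i : Fin 4) :
    chg g (X i) = ∑ j : Fin 4, g i j • X j := by simp [chg]

theorem chg_chg (g h : Matrix (Fin 4) (Fin 4) K) (q : PP K) :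
    chg h (chg g q) = chg (g * h) q := by
  have : (chg h).comp (chg g) = chg (g * h) := by
    apply MvPolynomial.algHom_ext
    intro i
    simp only [AlgHom.comp_apply, chg_X, map_sum, map_smul, Matrix.mul_apply, Finset.sum_smul,
      Finset.smul_sum, smul_smul]
    rw [Finset.sum_comm]
  rw [← this]; rfl

theorem chg_one (q : PP K) : chg (1 : Matrix (Fin 4) (Fin 4) K) q = q := by
  have : chg (1 : Matrix (Fin 4) (Fin 4) K) = AlgHom.id K _ := by
    apply MvPolynomial.algHom_ext
    intro i
    simp [chg_X, Matrix.one_apply]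
  rw [this]; rfl

theorem chg_inv (g : Matrix (Fin 4) (Fin 4) K) (hg : IsUnit g.det) (q : PP K) :
    chg g⁻¹ (chg g q) = q := by
  rw [chg_chg, Matrix.mul_nonsing_inv g hg, chg_one]

theorem chg_inv' (g : Matrix (Fin 4) (Fin 4) K) (hg : IsUnit g.det) (q : PP K) :
    chg g (chg g⁻¹ q) = q := by
  rw [chg_chg, Matrix.nonsing_inv_mul g hg, chg_one]

theorem chg_inj (g : Matrix (Fin 4) (Fin 4) K) (hg : IsUnit g.det) :
    Function.Injective (chg g) := by
  intro a b h
  rw [← chg_inv g hg a, h, chg_inv g hg]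

/-- the image of a space of forms under a change of coordinates -/
def mp (g : Matrix (Fin 4) (Fin 4) K) (V : Submodule K (PP K)) : Submodule K (PP K) :=
  Submodule.map (chg g).toLinearMap V

theorem mem_mp {g : Matrix (Fin 4) (Fin 4) K} {V : Submodule K (PP K)} {q : PP K} (hq : q ∈ V) :
    chg g q ∈ mp g V := ⟨q, hq, rfl⟩

theorem mem_of_mp {g : Matrix (Fin 4) (Fin 4) K} (hg : IsUnit g.det) {V : Submodule K (PP K)}
    {q : PP K} (hq : q ∈ mp g V) : chg g⁻¹ q ∈ V := by
  obtain ⟨r, hr, rfl⟩ := hq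
  have := chg_inv g hg r
  change chg g⁻¹ (chg g r) ∈ V
  rwa [this]

theorem finrank_mp (g : Matrix (Fin 4) (Fin 4) K) (hg : IsUnit g.det) (V : Submodule K (PP K)) :
    Module.finrank K (mp g V) = Module.finrank K V := by
  exact LinearEquiv.finrank_eq (Submodule.equivMapOfInjective (chg g).toLinearMap (chg_inj g hg) V).symm

/-- all gradients vanish -/
def sing (p : Fin 4 → K) (q : PP K) : Prop := ∀ i, eval p (pderiv i q) = 0

def JJ (V : Submodule K (PP K)) : Prop :=
  ∀ p : Fin 4 → K, ∃ q ∈ V, q ≠ 0 ∧ sing p q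

theorem eval_chg (g : Matrix (Fin 4) (Fin 4) K) (p : Fin 4 → K) (q : PP K) :
    eval p (chg g q) = eval (g.mulVec p) q := by
  induction q using MvPolynomial.induction_on with
  | C a => simp [chg]
  | add a b ha hb => simp [ha, hb]
  | mul_X a i ha =>
    simp [ha, chg_X, Matrix.mulVec, dotProduct, smul_eval]

theorem pderiv_chg (g : Matrix (Fin 4) (Fin 4) K) (j : Fin 4) (q : PP K) :
    pderiv j (chg g q) = ∑ i, g i j • chg g (pderiv i q) := by
  induction q using MvPolynomial.induction_on with
  | C a => simp [chg]
  | add a b ha hb => simp [ha, hb, Finset.sum_add_distrib]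
  | mul_X a i ha =>
    simp only [map_mul, Derivation.leibniz, ha, map_add, smul_add, Finset.sum_add_distrib,
      smul_eq_mul, pderiv_X, chg_X, map_sum, Derivation.map_smul]
    congr 1
    · simp [Pi.single_apply, Finset.sum_ite_eq, apply_ite (chg g), mul_comm]
    · rw [Finset.mul_sum]
      apply Finset.sum_congr rfl
      intro k _
      rw [mul_smul_comm]

theorem sing_chg {g : Matrix (Fin 4) (Fin 4) K} {p : Fin 4 → K} {q : PP K}
    (h : sing (g.mulVec p) q) : sing p (chg g q) := by
  intro j
  rw [pderiv_chg]
  simp only [map_sum, smul_eval, eval_chg]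
  exact Finset.sum_eq_zero (fun i _ => by rw [h i, mul_zero])

theorem JJ_mp {g : Matrix (Fin 4) (Fin 4) K} (hg : IsUnit g.det) {V : Submodule K (PP K)}
    (h : JJ V) : JJ (mp g V) := by
  intro p
  obtain ⟨q, hq, h0, hs⟩ := h (g.mulVec p)
  refine ⟨chg g q, mem_mp hq, ?_, sing_chg hs⟩
  intro h1
  exact h0 (chg_inj g hg (by rw [h1, map_zero]))

theorem span4 {V : Submodule K (PP K)} (hV : Module.finrank K V = 4) (v : Fin 4 → PP K)
    (hv : LinearIndependent K v) (hm : ∀ i, v i ∈ V) : V = Submodule.span K (Set.range v) := by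
  have : FiniteDimensional K V := FiniteDimensional.of_finrank_pos (by omega)
  symm
  apply Submodule.eq_of_le_of_finrank_eq
  · rw [Submodule.span_le]; rintro _ ⟨i, rfl⟩; exact hm i
  · rw [finrank_span_eq_card hv, hV]; simp

/-- the Jacobian determinant of four elements vanishes -/
theorem jac_det {V : Submodule K (PP K)} (hV : Module.finrank K V = 4) (hJ : JJ V)
    (v : Fin 4 → PP K)
    (hv : LinearIndependent K v) (hm : ∀ i, v i ∈ V) (p : Fin 4 → K) :
    (Matrix.of fun k i => eval p (pderiv i (v k))).det = 0 := by
  obtain ⟨q, hq, h0, hs⟩ := hJ p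
  rw [span4 hV v hv hm, Submodule.mem_span_range_iff_exists_fun] at hq
  obtain ⟨c, rfl⟩ := hq
  rw [← Matrix.exists_vecMul_eq_zero_iff]
  refine ⟨c, ?_, ?_⟩
  · rintro rfl; simp at h0
  · ext i
    have := hs i
    simp only [map_sum, Derivation.map_smul, smul_eval] at this
    simpa [Matrix.vecMul, dotProduct] using this

/-- second derivative functional, used to read off coefficients -/
def hs (i j : Fin 4) (q : PP K) : K := eval 0 (pderiv i (pderiv j q))

/-- four quadrics pulled back lie in `V` -/
def In4 (V : Submodule K (PP K)) (g : Matrix (Fin 4) (Fin 4) K) (a b c d : PP K) : Prop :=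
  chg g a ∈ V ∧ chg g b ∈ V ∧ chg g c ∈ V ∧ chg g d ∈ V

theorem In4_mp {V : Submodule K (PP K)} {h g : Matrix (Fin 4) (Fin 4) K} {a b c d : PP K}
    (hh : IsUnit h.det) (H : In4 (mp h V) g a b c d) : In4 V (g * h⁻¹) a b c d := by
  obtain ⟨h1, h2, h3, h4⟩ := H
  refine ⟨?_, ?_, ?_, ?_⟩ <;> rw [← chg_chg] <;> exact mem_of_mp hh (by assumption)

/-- the target classification -/
def Good (V : Submodule K (PP K)) : Prop :=
  ∃ g : Matrix (Fin 4) (Fin 4) K, IsUnit g.det ∧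
    (In4 V g (X 0 * X 2) (X 0 * X 3) (X 1 * X 2) (X 1 * X 3) ∨
     In4 V g (X 0 ^ 2) (X 1 ^ 2) (X 2 ^ 2) (X 0 * X 1 + X 0 * X 2 + X 1 * X 2) ∨
     In4 V g (X 0 ^ 2) (X 1 ^ 2) (X 2 ^ 2) (X 0 * X 2 + X 1 * X 2) ∨
     In4 V g (X 0 ^ 2) (X 0 * X 1) (X 0 * X 2 - X 1 ^ 2) (X 2 ^ 2) ∨
     In4 V g (X 0 ^ 2) (X 0 * X 1) (X 0 * X 2 - X 1 ^ 2) (X 1 * X 2) ∨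
     In4 V g (X 0 ^ 2) (X 0 * X 2) (X 1 ^ 2) (X 1 * X 2) ∨
     In4 V g (X 0 ^ 2) (X 0 * X 1) (X 0 * X 2) (X 1 * X 2) ∨
     In4 V g (X 0 ^ 2) (X 0 * X 1) (X 1 ^ 2) (X 2 * X 3) ∨
     In4 V g (X 0 ^ 2) (X 0 * X 1) (X 1 ^ 2) (X 2 ^ 2 + X 1 * X 3) ∨
     In4 V g (X 0 ^ 2) (X 0 * X 1) (X 1 ^ 2) (X 2 ^ 2) ∨
     In4 V g (X 0 ^ 2) (X 0 * X 1) (X 1 ^ 2) (X 0 * X 3 - X 1 * X 2) ∨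
     In4 V g (X 0 ^ 2) (X 0 * X 1) (X 1 ^ 2) (X 0 * X 2))

theorem Good_of_mp {V : Submodule K (PP K)} {h : Matrix (Fin 4) (Fin 4) K}
    (hh : IsUnit h.det) (H : Good (mp h V)) : Good V := by
  obtain ⟨g, hg, H⟩ := H
  refine ⟨g * h⁻¹, ?_, ?_⟩
  · rw [Matrix.det_mul]
    exact hg.mul (Matrix.isUnit_nonsing_inv_det _ hh)
  · rcases H with H|H|H|H|H|H|H|H|H|H|H|H <;> simp only [In4_mp hh H, true_or, or_true]

theorem In4_eq {V : Submodule K (PP K)} (hV : Module.finrank K V = 4)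
    {g : Matrix (Fin 4) (Fin 4) K} (hg : IsUnit g.det) {a b c d : PP K}
    (H : In4 V g a b c d) (hli : LinearIndependent K ![a, b, c, d]) :
    Submodule.map (chg g⁻¹).toLinearMap V = Submodule.span K {a, b, c, d} := by
  have hg' : IsUnit (g⁻¹).det := Matrix.isUnit_nonsing_inv_det _ hg
  have := span4 (V := mp g⁻¹ V) (by rw [finrank_mp _ hg', hV]) ![a, b, c, d] hli ?_
  · unfold mp at this
    rw [this]
    congr 1
    ext x
    simp [eq_comm]
    tauto
  · obtain ⟨h1, h2, h3, h4⟩ := H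
    have key : ∀ q, chg g q ∈ V → q ∈ mp g⁻¹ V := fun q hq => by
      have := mem_mp (g := g⁻¹) hq
      rwa [chg_inv g hg] at this
    intro i
    fin_cases i <;> apply key <;> assumption
end base

section li
variable {K : Type*} [Field K] [CharZero K]

theorem li_of (v : Fin 4 → PP K)
    (h : ∀ a b c d : K, C a * v 0 + C b * v 1 + C c * v 2 + C d * v 3 = 0 →
      a = 0 ∧ b = 0 ∧ c = 0 ∧ d = 0) : LinearIndependent K v := by
  rw [Fintype.linearIndependent_iff]
  intro g hg
  obtain ⟨h1, h2, h3, h4⟩ := h (g 0) (g 1) (g 2) (g 3) (by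
    rw [← hg]; simp [Fin.sum_univ_four, smul_eq_C_mul])
  intro i; fin_cases i <;> assumption

theorem cc2 : constantCoeff (2 : PP K) = 2 := map_ofNat _ 2

set_option maxHeartbeats 2000000 in
theorem Good_final {V : Submodule K (PP K)} (hV : Module.finrank K V = 4) (H : Good V) :
    ∃ g : Matrix (Fin 4) (Fin 4) K, IsUnit g.det ∧
      (Submodule.map (chg g).toLinearMap V =
          Submodule.span K {X 0 * X 2, X 0 * X 3, X 1 * X 2, X 1 * X 3} ∨
       Submodule.map (chg g).toLinearMap V =
          Submodule.span K {X 0 ^ 2, X 1 ^ 2, X 2 ^ 2, X 0 * X 1 + X 0 * X 2 + X 1 * X 2} ∨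
       Submodule.map (chg g).toLinearMap V =
          Submodule.span K {X 0 ^ 2, X 1 ^ 2, X 2 ^ 2, X 0 * X 2 + X 1 * X 2} ∨
       Submodule.map (chg g).toLinearMap V =
          Submodule.span K {X 0 ^ 2, X 0 * X 1, X 0 * X 2 - X 1 ^ 2, X 2 ^ 2} ∨
       Submodule.map (chg g).toLinearMap V =
          Submodule.span K {X 0 ^ 2, X 0 * X 1, X 0 * X 2 - X 1 ^ 2, X 1 * X 2} ∨
       Submodule.map (chg g).toLinearMap V =
          Submodule.span K {X 0 ^ 2, X 0 * X 2, X 1 ^ 2, X 1 * X 2} ∨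
       Submodule.map (chg g).toLinearMap V =
          Submodule.span K {X 0 ^ 2, X 0 * X 1, X 0 * X 2, X 1 * X 2} ∨
       Submodule.map (chg g).toLinearMap V =
          Submodule.span K {X 0 ^ 2, X 0 * X 1, X 1 ^ 2, X 2 * X 3} ∨
       Submodule.map (chg g).toLinearMap V =
          Submodule.span K {X 0 ^ 2, X 0 * X 1, X 1 ^ 2, X 2 ^ 2 + X 1 * X 3} ∨
       Submodule.map (chg g).toLinearMap V =
          Submodule.span K {X 0 ^ 2, X 0 * X 1, X 1 ^ 2, X 2 ^ 2} ∨
       Submodule.map (chg g).toLinearMap V =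
          Submodule.span K {X 0 ^ 2, X 0 * X 1, X 1 ^ 2, X 0 * X 3 - X 1 * X 2} ∨
       Submodule.map (chg g).toLinearMap V =
          Submodule.span K {X 0 ^ 2, X 0 * X 1, X 1 ^ 2, X 0 * X 2}) := by
  obtain ⟨g, hg, H⟩ := H
  refine ⟨g⁻¹, Matrix.isUnit_nonsing_inv_det _ hg, ?_⟩
  rcases H with H|H|H|H|H|H|H|H|H|H|H|H
  all_goals
    have := In4_eq hV hg H (by
      apply li_of
      intro a b c d h
      have e : ∀ i j, hs i j _ = hs i j 0 := fun i j => congrArg (hs i j) h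
      have e00 := e 0 0
      have e01 := e 0 1
      have e02 := e 0 2
      have e03 := e 0 3
      have e11 := e 1 1
      have e12 := e 1 2
      have e13 := e 1 3
      have e22 := e 2 2
      have e23 := e 2 3
      simp [hs, pderiv_X, cc2] at e00 e01 e02 e03 e11 e12 e13 e22 e23
      simp_all)
    simp only [this, true_or, or_true]
end li
end

section

section two
variable {K : Type*} [Field K] [CharZero K]

theorem peq {a b : PP K} (h : ∀ p : Fin 4 → K, eval p a = eval p b) : a = b := by
  have : Infinite K := CharZero.infinite K
  exact MvPolynomial.funext h

theorem mem4 {V : Submodule K (PP K)} {q1 q2 q3 q4 p : PP K} (h1 : q1 ∈ V) (h2 : q2 ∈ V)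
    (h3 : q3 ∈ V) (h4 : q4 ∈ V) (a b c d : K)
    (e : p = C a * q1 + C b * q2 + C c * q3 + C d * q4) : p ∈ V := by
  rw [e]
  simp only [← smul_eq_C_mul]
  exact V.add_mem (V.add_mem (V.add_mem (V.smul_mem _ h1) (V.smul_mem _ h2)) (V.smul_mem _ h3))
    (V.smul_mem _ h4)

theorem mem4' {V : Submodule K (PP K)} {q1 q2 q3 q4 p : PP K} (h1 : q1 ∈ V) (h2 : q2 ∈ V)
    (h3 : q3 ∈ V) (h4 : q4 ∈ V) (a b c d : K)
    (e : ∀ x : Fin 4 → K, eval x p = a * eval x q1 + b * eval x q2 + c * eval x q3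
      + d * eval x q4) : p ∈ V :=
  mem4 h1 h2 h3 h4 a b c d (peq fun x => by rw [e x]; simp)

/-- explicit matrix-vector product -/
def mv (g : Matrix (Fin 4) (Fin 4) K) (x : Fin 4 → K) : Fin 4 → K :=
  fun i => g i 0 * x 0 + g i 1 * x 1 + g i 2 * x 2 + g i 3 * x 3

theorem eval_chg' (g : Matrix (Fin 4) (Fin 4) K) (x : Fin 4 → K) (q : PP K) :
    eval x (chg g q) = eval (mv g x) q := by
  rw [eval_chg]
  congr 2
  ext i
  simp [Matrix.mulVec, dotProduct, Fin.sum_univ_four, mv]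

theorem memchg {V : Submodule K (PP K)} {g : Matrix (Fin 4) (Fin 4) K} {q p : PP K} (h : q ∈ V)
    (e : ∀ x : Fin 4 → K, eval x p = eval (mv g x) q) : p ∈ mp g V := by
  have : p = chg g q := peq fun x => by rw [e x, eval_chg']
  rw [this]; exact mem_mp h

theorem det4 (a b c d e f g h i j k l m n o p : K) :
    (!![a, b, c, d; e, f, g, h; i, j, k, l; m, n, o, p]).det =
    a * (f * (k * p - l * o) - g * (j * p - l * n) + h * (j * o - k * n))
    - b * (e * (k * p - l * o) - g * (i * p - l * m) + h * (i * o - k * m))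
    + c * (e * (j * p - l * n) - f * (i * p - l * m) + h * (i * n - j * m))
    - d * (e * (j * o - k * n) - f * (i * o - k * m) + g * (i * n - j * m)) := by
  simp [Matrix.det_succ_row_zero, Fin.sum_univ_succ, Fin.succAbove]
  ring

/-- binary quadratic forms over an algebraically closed field -/
theorem bin [IsAlgClosed K] (a b c : K) : ∃ p q r s : K, p * s - q * r ≠ 0 ∧
    ((a * p ^ 2 + b * p * r + c * r ^ 2 = 0 ∧ a * q ^ 2 + b * q * s + c * s ^ 2 = 0 ∧
      2 * a * p * q + b * (p * s + q * r) + 2 * c * r * s = 1) ∨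
     (a * p ^ 2 + b * p * r + c * r ^ 2 = 1 ∧ a * q ^ 2 + b * q * s + c * s ^ 2 = 0 ∧
      2 * a * p * q + b * (p * s + q * r) + 2 * c * r * s = 0) ∨
     (a = 0 ∧ b = 0 ∧ c = 0)) := by
  have main : ∀ a b c : K, a ≠ 0 → ∃ p q r s : K, p * s - q * r ≠ 0 ∧
    ((a * p ^ 2 + b * p * r + c * r ^ 2 = 0 ∧ a * q ^ 2 + b * q * s + c * s ^ 2 = 0 ∧
      2 * a * p * q + b * (p * s + q * r) + 2 * c * r * s = 1) ∨
     (a * p ^ 2 + b * p * r + c * r ^ 2 = 1 ∧ a * q ^ 2 + b * q * s + c * s ^ 2 = 0 ∧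
      2 * a * p * q + b * (p * s + q * r) + 2 * c * r * s = 0) ∨
     (a = 0 ∧ b = 0 ∧ c = 0)) := by
    intro a b c ha
    obtain ⟨d, hd⟩ := IsAlgClosed.exists_pow_nat_eq (b ^ 2 - 4 * a * c) (n := 2) (by norm_num)
    have h2 : (2 : K) ≠ 0 := two_ne_zero
    by_cases hd0 : d = 0
    · obtain ⟨t, ht⟩ := IsAlgClosed.exists_pow_nat_eq a (n := 2) (by norm_num)
      have ht0 : t ≠ 0 := by rintro rfl; apply ha; rw [← ht]; ring
      subst hd0
      refine ⟨1 / t, -b, 0, 2 * a, ?_, Or.inr (Or.inl ⟨?_, ?_, ?_⟩)⟩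
      · field_simp; simp [ht0, ha]
      · field_simp; linear_combination -ht
      · linear_combination a * hd
      · field_simp; ring
    · refine ⟨-b + d, (-b - d) * (-1 / (4 * a * d ^ 2)), 2 * a, 2 * a * (-1 / (4 * a * d ^ 2)),
        ?_, Or.inl ⟨?_, ?_, ?_⟩⟩
      · field_simp
        simp only [ne_eq, zero_mul, mul_eq_zero, not_or, neg_eq_zero, one_ne_zero, div_eq_zero_iff]
        have : -d - d ≠ 0 := fun h => hd0 (by
          apply mul_left_cancel₀ h2; linear_combination -h)
        simp
        exact ⟨this, hd0⟩
      · linear_combination a * hd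
      · have : a * (-b - d) ^ 2 + b * (-b - d) * (2 * a) + c * (2 * a) ^ 2 = 0 := by
          linear_combination a * hd
        linear_combination (-1 / (4 * a * d ^ 2)) ^ 2 * this
      · field_simp; linear_combination (-2) * hd
  by_cases ha : a = 0
  · by_cases hc : c = 0
    · by_cases hb : b = 0
      · exact ⟨1, 0, 0, 1, by simp, Or.inr (Or.inr ⟨ha, hb, hc⟩)⟩
      · subst ha hc
        exact ⟨1, 0, 0, 1 / b, by simp [hb], Or.inl ⟨by simp, by simp, by simp [hb]⟩⟩
    · obtain ⟨p, q, r, s, h, H⟩ := main c b a hc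
      refine ⟨r, s, p, q, ?_, ?_⟩
      · intro h'; apply h; linear_combination -h'
      · rcases H with ⟨h1, h2, h3⟩ | ⟨h1, h2, h3⟩ | ⟨h1, h2, h3⟩
        · refine Or.inl ⟨?_, ?_, ?_⟩
          · linear_combination h1
          · linear_combination h2
          · linear_combination h3
        · refine Or.inr (Or.inl ⟨?_, ?_, ?_⟩)
          · linear_combination h1
          · linear_combination h2
          · linear_combination h3
        · exact absurd h1 hc
  · exact main a b c ha

/-- the part of a quadric that matters modulo `(X0, X1)^2` -/
def qB (a b c d e f h : K) : PP K :=
  C a * X 2 ^ 2 + C b * (X 2 * X 3) + C c * X 3 ^ 2 + X 0 * (C d * X 2 + C e * X 3) +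
    X 1 * (C f * X 2 + C h * X 3)

variable {V : Submodule K (PP K)}

theorem B1 (h00 : X 0 ^ 2 ∈ V) (h01 : X 0 * X 1 ∈ V) (h11 : X 1 ^ 2 ∈ V) (d e f h : K)
    (hq : qB 0 1 0 d e f h ∈ V) : Good V := by
  refine ⟨!![1, 0, 0, 0; 0, 1, 0, 0; e, h, 1, 0; d, f, 0, 1], by simp [det4], ?_⟩
  iterate 7 right
  left
  refine ⟨mem4' h00 h01 h11 hq 1 0 0 0 ?_, mem4' h00 h01 h11 hq 0 1 0 0 ?_,
    mem4' h00 h01 h11 hq 0 0 1 0 ?_, mem4' h00 h01 h11 hq (e * d) (e * f + h * d) (h * f) 1 ?_⟩ <;>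
  · intro x
    simp [eval_chg', mv, qB]
    try ring

theorem B2 (h00 : X 0 ^ 2 ∈ V) (h01 : X 0 * X 1 ∈ V) (h11 : X 1 ^ 2 ∈ V) (d e f h : K)
    (hq : qB 1 0 0 d e f h ∈ V) : Good V := by
  by_cases hh : h = 0
  · by_cases he : e = 0
    · subst hh he
      refine ⟨!![1, 0, 0, 0; 0, 1, 0, 0; d / 2, f / 2, 1, 0; 0, 0, 0, 1], by simp [det4], ?_⟩
      iterate 9 right
      left
      refine ⟨mem4' h00 h01 h11 hq 1 0 0 0 ?_, mem4' h00 h01 h11 hq 0 1 0 0 ?_,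
        mem4' h00 h01 h11 hq 0 0 1 0 ?_,
        mem4' h00 h01 h11 hq (d ^ 2 / 4) (d * f / 2) (f ^ 2 / 4) 1 ?_⟩ <;>
      · intro x
        simp [eval_chg', mv, qB]
        try ring
    · subst hh
      refine ⟨!![0, 1, 0, 0; e, 0, 0, 0; d / 2, f / 2, 1, 0; 0, 0, 0, 1], by simp [det4, he], ?_⟩
      iterate 8 right
      left
      refine ⟨mem4' h00 h01 h11 hq 0 0 1 0 ?_, mem4' h00 h01 h11 hq 0 e 0 0 ?_,
        mem4' h00 h01 h11 hq (e ^ 2) 0 0 0 ?_,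
        mem4' h00 h01 h11 hq (d ^ 2 / 4) (d * f / 2) (f ^ 2 / 4) 1 ?_⟩ <;>
      · intro x
        simp [eval_chg', mv, qB]
        try ring
  · refine ⟨!![1, 0, 0, 0; e, h, 0, 0; d / 2, f / 2, 1, 0; 0, 0, 0, 1], by simp [det4, hh], ?_⟩
    iterate 8 right
    left
    refine ⟨mem4' h00 h01 h11 hq 1 0 0 0 ?_, mem4' h00 h01 h11 hq e h 0 0 ?_,
      mem4' h00 h01 h11 hq (e ^ 2) (2 * e * h) (h ^ 2) 0 ?_,
      mem4' h00 h01 h11 hq (d ^ 2 / 4) (d * f / 2) (f ^ 2 / 4) 1 ?_⟩ <;>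
    · intro x
      simp [eval_chg', mv, qB]
      try ring

theorem B3 (h00 : X 0 ^ 2 ∈ V) (h01 : X 0 * X 1 ∈ V) (h11 : X 1 ^ 2 ∈ V) (d e f h : K)
    (hq : qB 0 0 0 d e f h ∈ V) (h0 : ¬ (d = 0 ∧ e = 0 ∧ f = 0 ∧ h = 0)) : Good V := by
  by_cases hD : d * h - e * f = 0
  · have fin : ∀ s t u v k l : K, s ≠ 0 ∨ t ≠ 0 → u ≠ 0 ∨ v ≠ 0 → 
        d = s * u → e = s * v → f = t * u → h = t * v → Good V := by
      intro s t u v k l hst huv hd he hf hh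
      obtain ⟨s', t', hs'⟩ : ∃ s' t', s * t' - t * s' ≠ 0 := by
        by_cases hs : s = 0
        · exact ⟨1, 0, by simpa [hs] using hst⟩
        · exact ⟨0, 1, by simpa using hs⟩
      obtain ⟨u', v', hu'⟩ : ∃ s' t', u * t' - v * s' ≠ 0 := by
        by_cases hs : u = 0
        · exact ⟨1, 0, by simpa [hs] using huv⟩
        · exact ⟨0, 1, by simpa using hs⟩
      refine ⟨!![s, t, 0, 0; s', t', 0, 0; 0, 0, u, v; 0, 0, u', v'], ?_, ?_⟩
      · rw [det4, isUnit_iff_ne_zero]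
        intro h; apply mul_ne_zero hs' hu'; linear_combination h
      · iterate 11 right
        refine ⟨mem4' h00 h01 h11 hq (s ^ 2) (2 * s * t) (t ^ 2) 0 ?_,
          mem4' h00 h01 h11 hq (s * s') (s * t' + s' * t) (t * t') 0 ?_,
          mem4' h00 h01 h11 hq (s' ^ 2) (2 * s' * t') (t' ^ 2) 0 ?_,
          mem4' h00 h01 h11 hq 0 0 0 1 ?_⟩ <;>
        · intro x
          simp [eval_chg', mv, qB, hd, he, hf, hh]
          try ring
    by_cases hd : d = 0
    · by_cases he : e = 0
      · subst hd he
        exact fin 0 1 f h 0 0 (by simp) (by by_contra hc; push Not at hc; simp [hc] at h0)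
          (by ring) (by ring) (by ring) (by ring)
      · refine fin 1 (h / e) d e 0 0 (by simp) (by simp [he]) (by ring) (by ring) ?_ ?_
        · field_simp; linear_combination -hD
        · field_simp
    · refine fin 1 (f / d) d e 0 0 (by simp) (by simp [hd]) (by ring) (by ring) ?_ ?_
      · field_simp
      · field_simp; linear_combination hD
  · refine ⟨!![1, 0, 0, 0; 0, 1, 0, 0; 0, 0, -f, -h; 0, 0, d, e], ?_, ?_⟩
    · rw [det4, isUnit_iff_ne_zero]
      intro h; apply hD; linear_combination h
    · iterate 10 right
      left
      refine ⟨mem4' h00 h01 h11 hq 1 0 0 0 ?_, mem4' h00 h01 h11 hq 0 1 0 0 ?_,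
        mem4' h00 h01 h11 hq 0 0 1 0 ?_, mem4' h00 h01 h11 hq 0 0 0 1 ?_⟩ <;>
      · intro x
        simp [eval_chg', mv, qB]
        try ring

theorem BB [IsAlgClosed K] (h00 : X 0 ^ 2 ∈ V) (h01 : X 0 * X 1 ∈ V) (h11 : X 1 ^ 2 ∈ V)
    (a b c d e f h : K)
    (hq : qB a b c d e f h ∈ V)
    (h0 : ¬ (a = 0 ∧ b = 0 ∧ c = 0 ∧ d = 0 ∧ e = 0 ∧ f = 0 ∧ h = 0)) : Good V := by
  obtain ⟨p, q, r, s, hD, H⟩ := bin a b c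
  have hg : IsUnit (!![1, 0, 0, 0; 0, 1, 0, 0; 0, 0, p, q; 0, 0, r, s]).det := by
    rw [det4, isUnit_iff_ne_zero]; intro h; apply hD; linear_combination h
  have h00' : X 0 ^ 2 ∈ mp !![1, 0, 0, 0; 0, 1, 0, 0; 0, 0, p, q; 0, 0, r, s] V :=
    memchg h00 (fun x => by simp [mv])
  have h01' : X 0 * X 1 ∈ mp !![1, 0, 0, 0; 0, 1, 0, 0; 0, 0, p, q; 0, 0, r, s] V :=
    memchg h01 (fun x => by simp [mv])
  have h11' : X 1 ^ 2 ∈ mp !![1, 0, 0, 0; 0, 1, 0, 0; 0, 0, p, q; 0, 0, r, s] V :=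
    memchg h11 (fun x => by simp [mv])
  rcases H with ⟨h1, h2, h3⟩ | ⟨h1, h2, h3⟩ | ⟨h1, h2, h3⟩
  · apply Good_of_mp hg
    refine B1 h00' h01' h11' (d * p + e * r) (d * q + e * s) (f * p + h * r) (f * q + h * s) 
      (memchg hq (fun x => ?_))
    simp [mv, qB]
    linear_combination -(x 2) ^ 2 * h1 - (x 3) ^ 2 * h2 - (x 2) * (x 3) * h3
  · apply Good_of_mp hg
    refine B2 h00' h01' h11' (d * p + e * r) (d * q + e * s) (f * p + h * r) (f * q + h * s) 
      (memchg hq (fun x => ?_))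
    simp [mv, qB]
    linear_combination -(x 2) ^ 2 * h1 - (x 3) ^ 2 * h2 - (x 2) * (x 3) * h3
  · subst h1 h2 h3
    exact B3 h00 h01 h11 d e f h hq (by simpa using h0)
end two
end

section

section three
variable {K : Type*} [Field K] [CharZero K]

/-- ternary quadratic form attached to a matrix -/
def quad3 (A : Matrix (Fin 3) (Fin 3) K) : PP K :=
  ∑ i : Fin 3, ∑ j : Fin 3, C (A i j) * (X i.castSucc * X j.castSucc)

/-- `V` contains the perp of the pencil spanned by `D`, `Q`. -/
def TT (D Q : Matrix (Fin 3) (Fin 3) K) (V : Submodule K (PP K)) : Prop :=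
  ∀ A : Matrix (Fin 3) (Fin 3) K, (D * A).trace = 0 → (Q * A).trace = 0 → quad3 A ∈ V

/-- the pencil leads to a good space -/
def PG (D Q : Matrix (Fin 3) (Fin 3) K) : Prop :=
  ∀ V : Submodule K (PP K), TT D Q V → Good V

/-- block embedding -/
def emb (g : Matrix (Fin 3) (Fin 3) K) : Matrix (Fin 4) (Fin 4) K :=
  !![g 0 0, g 0 1, g 0 2, 0; g 1 0, g 1 1, g 1 2, 0; g 2 0, g 2 1, g 2 2, 0; 0, 0, 0, 1]

theorem emb_det (g : Matrix (Fin 3) (Fin 3) K) : (emb g).det = g.det := by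
  rw [emb, det4, Matrix.det_fin_three]; ring

theorem chg_emb (g A : Matrix (Fin 3) (Fin 3) K) :
    chg (emb g) (quad3 A) = quad3 (g.transpose * A * g) := by
  apply peq
  intro x
  rw [eval_chg']
  simp [quad3, Fin.sum_univ_three, mv, emb, Matrix.mul_apply, Fin.castSucc]
  ring

theorem PG_congr {D Q h : Matrix (Fin 3) (Fin 3) K} (hh : IsUnit h.det)
    (H : PG (h * D * h.transpose) (h * Q * h.transpose)) : PG D Q := by
  intro V hV
  have hu : IsUnit (emb h⁻¹).det := by
    rw [emb_det]; exact Matrix.isUnit_nonsing_inv_det _ hh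
  apply Good_of_mp hu
  apply H
  intro A h1 h2
  have key : ∀ M : Matrix (Fin 3) (Fin 3) K, (M * (h.transpose * A * h)).trace =
      (h * M * h.transpose * A).trace := by
    intro M
    rw [← Matrix.mul_assoc, Matrix.trace_mul_comm]
    simp only [Matrix.mul_assoc]
  have hm := hV (h.transpose * A * h) (by rw [key, h1]) (by rw [key, h2])
  have := mem_mp (g := emb h⁻¹) hm
  rw [chg_emb] at this
  have e : (h⁻¹).transpose * (h.transpose * A * h) * h⁻¹ = A := by
    have a1 : h * h⁻¹ = 1 := Matrix.mul_nonsing_inv h hh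
    have a2 : (h⁻¹).transpose * h.transpose = 1 := by
      rw [← Matrix.transpose_mul, a1, Matrix.transpose_one]
    calc _ = ((h⁻¹).transpose * h.transpose) * A * (h * h⁻¹) := by simp only [Matrix.mul_assoc]
      _ = A := by rw [a1, a2]; simp
  rwa [e] at this

theorem PG_swap {D Q : Matrix (Fin 3) (Fin 3) K} (H : PG Q D) : PG D Q :=
  fun V hV => H V (fun A h1 h2 => hV A h2 h1)

theorem PG_sub {D Q : Matrix (Fin 3) (Fin 3) K} (t : K) (H : PG (t • Q - D) Q) : PG D Q :=
  fun V hV => H V (fun A h1 h2 => hV A (by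
    rw [Matrix.sub_mul, Matrix.trace_sub, Matrix.smul_mul, Matrix.trace_smul, h2] at h1
    simpa using h1) h2)

/-- symmetric matrix -/
def sm (a b c d e f : K) : Matrix (Fin 3) (Fin 3) K := !![a, d, e; d, b, f; e, f, c]

theorem tr3 (M A : Matrix (Fin 3) (Fin 3) K) : (M * A).trace =
    M 0 0 * A 0 0 + M 0 1 * A 1 0 + M 0 2 * A 2 0 + (M 1 0 * A 0 1 + M 1 1 * A 1 1 + M 1 2 * A 2 1)
    + (M 2 0 * A 0 2 + M 2 1 * A 1 2 + M 2 2 * A 2 2) := by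
  simp only [Matrix.trace, Fin.sum_univ_three, Matrix.mul_apply, Matrix.diag_apply]

theorem TT_mem {a b c d e f a' b' c' d' e' f' : K} {V : Submodule K (PP K)}
    (H : TT (sm a b c d e f) (sm a' b' c' d' e' f') V) {p : PP K} (x y z u v w : K)
    (h1 : a * x + b * y + c * z + d * u + e * v + f * w = 0)
    (h2 : a' * x + b' * y + c' * z + d' * u + e' * v + f' * w = 0)
    (h : ∀ s : Fin 4 → K, eval s p = x * s 0 ^ 2 + y * s 1 ^ 2 + z * s 2 ^ 2 + u * (s 0 * s 1) +
      v * (s 0 * s 2) + w * (s 1 * s 2)) : p ∈ V := by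
  have := H !![x, u, v; 0, y, w; 0, 0, z] ?_ ?_
  · convert this using 1
    apply peq
    intro s
    rw [h]
    simp [quad3, Fin.sum_univ_three, Fin.castSucc]
    ring
  · refine Eq.trans ?_ h1
    rw [tr3]; simp [sm]
    ring
  · refine Eq.trans ?_ h2
    rw [tr3]; simp [sm]
    ring

theorem TT_mk {a b c d e f a' b' c' d' e' f' : K} {V : Submodule K (PP K)}
    (H : ∀ x y z u v w : K, a * x + b * y + c * z + d * u + e * v + f * w = 0 →
      a' * x + b' * y + c' * z + d' * u + e' * v + f' * w = 0 →
      ∃ p ∈ V, ∀ s : Fin 4 → K, eval s p = x * s 0 ^ 2 + y * s 1 ^ 2 + z * s 2 ^ 2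
        + u * (s 0 * s 1) + v * (s 0 * s 2) + w * (s 1 * s 2)) :
    TT (sm a b c d e f) (sm a' b' c' d' e' f') V := by
  intro A h1 h2
  obtain ⟨p, hp, h⟩ := H (A 0 0) (A 1 1) (A 2 2) (A 0 1 + A 1 0) (A 0 2 + A 2 0) (A 1 2 + A 2 1)
    (by
      rw [← h1]
      rw [tr3]; simp [sm]
      ring)
    (by
      rw [← h2]
      rw [tr3]; simp [sm]
      ring)
  convert hp using 1
  apply peq
  intro s
  rw [h]
  simp [quad3, Fin.sum_univ_three, Fin.castSucc]
  ring

/-- the pencil is genuinely two-dimensional -/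
def IndP (D Q : Matrix (Fin 3) (Fin 3) K) : Prop :=
  ∀ s t : K, s • D + t • Q = 0 → s = 0 ∧ t = 0

theorem IndP_congr {D Q h : Matrix (Fin 3) (Fin 3) K} (hh : IsUnit h.det) (H : IndP D Q) :
    IndP (h * D * h.transpose) (h * Q * h.transpose) := by
  intro s t e
  apply H
  have a1 : h⁻¹ * h = 1 := Matrix.nonsing_inv_mul h hh
  have a2 : h.transpose * (h⁻¹).transpose = 1 := by
    rw [← Matrix.transpose_mul, a1, Matrix.transpose_one]
  have e2 : h⁻¹ * (s • (h * D * h.transpose) + t • (h * Q * h.transpose)) * (h⁻¹).transpose = 0 := by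
    rw [e]; simp
  have k : ∀ M : Matrix (Fin 3) (Fin 3) K, h⁻¹ * (h * M * h.transpose) * (h⁻¹).transpose = M := by
    intro M
    calc _ = (h⁻¹ * h) * M * (h.transpose * (h⁻¹).transpose) := by simp only [Matrix.mul_assoc]
      _ = M := by rw [a1, a2]; simp
  rw [← e2, Matrix.mul_add, Matrix.add_mul, Matrix.mul_smul, Matrix.mul_smul, Matrix.smul_mul,
    Matrix.smul_mul, k, k]

theorem sm_of {M : Matrix (Fin 3) (Fin 3) K} (h : M.IsSymm) :
    M = sm (M 0 0) (M 1 1) (M 2 2) (M 0 1) (M 0 2) (M 1 2) := by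
  have := h.apply
  ext i j
  fin_cases i <;> fin_cases j <;> simp [sm] <;> rw [this]

theorem symm_congr {M h : Matrix (Fin 3) (Fin 3) K} (hM : M.IsSymm) :
    (h * M * h.transpose).IsSymm := by
  unfold Matrix.IsSymm at *
  rw [Matrix.transpose_mul, Matrix.transpose_mul, Matrix.transpose_transpose, hM, Matrix.mul_assoc]

/-- singular symmetric matrices -/
theorem sing_red [IsAlgClosed K] {D : Matrix (Fin 3) (Fin 3) K} (hD : D.IsSymm) (h0 : D ≠ 0)
    (hd : D.det = 0) : ∃ h : Matrix (Fin 3) (Fin 3) K, IsUnit h.det ∧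
      (h * D * h.transpose = sm 0 0 0 (1 / 2) 0 0 ∨ h * D * h.transpose = sm 1 0 0 0 0 0) := by
  obtain ⟨v, hv, hvD⟩ := Matrix.exists_vecMul_eq_zero_iff.mpr hd
  obtain ⟨h1, hh1, hr⟩ : ∃ h : Matrix (Fin 3) (Fin 3) K, IsUnit h.det ∧ h 2 = v := by
    by_cases c0 : v 0 = 0
    · by_cases c1 : v 1 = 0
      · have c2 : v 2 ≠ 0 := by
          intro c2; apply hv; ext i; fin_cases i <;> assumption
        refine ⟨Matrix.of ![![1, 0, 0], ![0, 1, 0], v], ?_, rfl⟩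
        rw [Matrix.det_fin_three, isUnit_iff_ne_zero]
        simpa [c0, c1] using c2
      · refine ⟨Matrix.of ![![1, 0, 0], ![0, 0, 1], v], ?_, rfl⟩
        rw [Matrix.det_fin_three, isUnit_iff_ne_zero]
        simpa [c0] using c1
    · refine ⟨Matrix.of ![![0, 1, 0], ![0, 0, 1], v], ?_, rfl⟩
      rw [Matrix.det_fin_three, isUnit_iff_ne_zero]
      simpa using c0
  set E := h1 * D * h1.transpose with hE
  have hEs : E.IsSymm := symm_congr hD
  have hE2 : ∀ j, E 2 j = 0 := by
    intro j
    have : (h1 * D) 2 = 0 := by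
      ext k
      have := congrFun hvD k
      rw [← hr] at this
      simpa [Matrix.vecMul, Matrix.mul_apply, dotProduct] using this
    rw [hE, Matrix.mul_apply]
    apply Finset.sum_eq_zero
    intro k _
    rw [this]; simp
  have hE3 : ∀ j, E j 2 = 0 := fun j => by rw [← hEs.apply]; exact hE2 j
  have hEsm := sm_of hEs
  rw [hE3 0, hE3 1, hE3 2] at hEsm
  generalize E 0 0 = a at hEsm
  generalize E 1 1 = b at hEsm
  generalize E 0 1 = d at hEsm
  obtain ⟨p, q, r, s, hdet, H⟩ := bin a (2 * d) b
  have hu : IsUnit (!![p, r, 0; q, s, 0; 0, 0, 1] * h1).det := by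
    rw [Matrix.det_mul]
    refine IsUnit.mul ?_ hh1
    rw [Matrix.det_fin_three, isUnit_iff_ne_zero]
    simp
    intro h; apply hdet; linear_combination h
  have hc : ∀ m : Matrix (Fin 3) (Fin 3) K, m * h1 * D * (m * h1).transpose =
      m * E * m.transpose := by
    intro m; rw [Matrix.transpose_mul, hE]; simp only [Matrix.mul_assoc]
  refine ⟨!![p, r, 0; q, s, 0; 0, 0, 1] * h1, hu, ?_⟩
  rw [hc, hEsm]
  have h2 : (2 : K) ≠ 0 := two_ne_zero
  rcases H with ⟨k1, k2, k3⟩ | ⟨k1, k2, k3⟩ | ⟨k1, k2, k3⟩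
  · left
    ext i j
    fin_cases i <;> fin_cases j <;> simp [sm, Matrix.mul_apply, Fin.sum_univ_three]
    · linear_combination k1
    · linear_combination k3 / 2
    · linear_combination k3 / 2
    · linear_combination k2
  · right
    ext i j
    fin_cases i <;> fin_cases j <;> simp [sm, Matrix.mul_apply, Fin.sum_univ_three]
    · linear_combination k1
    · linear_combination k3 / 2
    · linear_combination k3 / 2
    · linear_combination k2
  · exfalso
    have hd0 : d = 0 := by simpa using k2
    rw [k1, k3, hd0] at hEsm
    have hE0 : E = 0 := by
      rw [hEsm]; ext i j; fin_cases i <;> fin_cases j <;> simp [sm]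
    apply h0
    have a1 : h1⁻¹ * h1 = 1 := Matrix.nonsing_inv_mul h1 hh1
    have a2 : h1.transpose * (h1⁻¹).transpose = 1 := by
      rw [← Matrix.transpose_mul, a1, Matrix.transpose_one]
    calc D = (h1⁻¹ * h1) * D * (h1.transpose * (h1⁻¹).transpose) := by rw [a1, a2]; simp
      _ = h1⁻¹ * E * (h1⁻¹).transpose := by rw [hE]; simp only [Matrix.mul_assoc]
      _ = 0 := by rw [hE0]; simp

theorem two_ne : (2 : K) ≠ 0 := two_ne_zero
end three
end

section

section four
variable {K : Type*} [Field K] [CharZero K]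

theorem XY_c [IsAlgClosed K] {a b c d e f : K} (hc : c ≠ 0) :
    PG (sm 0 0 0 (1 / 2) 0 0) (sm a b c d e f) := by
  intro V H
  have n2 : (2 : K) ≠ 0 := two_ne_zero
  obtain ⟨α, hα⟩ := IsAlgClosed.exists_pow_nat_eq (e ^ 2 - a * c) (n := 2) (by norm_num)
  obtain ⟨β, hβ⟩ := IsAlgClosed.exists_pow_nat_eq (f ^ 2 - b * c) (n := 2) (by norm_num)
  by_cases ha : α = 0
  · by_cases hb : β = 0
    · subst ha hb
      refine ⟨!![c, 0, -e, 0; 0, c, -f, 0; 0, 0, 1, 0; 0, 0, 0, 1], ?_, ?_⟩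
      · rw [det4, isUnit_iff_ne_zero]
        simp [hc]
      · iterate 5 right
        left
        exact ⟨TT_mem H ((c)^2) ((0)^2) ((-e)^2) (2*(c)*(0)) (2*(c)*(-e)) (2*(0)*(-e))
          (by ring) (by linear_combination c * hα) (fun s => by simp [eval_chg', mv]; try ring),
          TT_mem H ((c)*(0)) ((0)*(0)) ((-e)*(1)) ((c)*(0)+(0)*(0)) ((c)*(1)+(-e)*(0)) ((0)*(1)+(-e)*(0))
          (by ring) (by ring) (fun s => by simp [eval_chg', mv]; try ring),
          TT_mem H ((0)^2) ((c)^2) ((-f)^2) (2*(0)*(c)) (2*(0)*(-f)) (2*(c)*(-f))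
          (by ring) (by linear_combination c * hβ) (fun s => by simp [eval_chg', mv]; try ring),
          TT_mem H ((0)*(0)) ((c)*(0)) ((-f)*(1)) ((0)*(0)+(c)*(0)) ((0)*(1)+(-f)*(0)) ((c)*(1)+(-f)*(0))
          (by ring) (by ring) (fun s => by simp [eval_chg', mv]; try ring)⟩
    · subst ha
      refine ⟨!![0, c, -f+β, 0; -1*(0), -1*(c), -1*(-f-β), 0; c, 0, -e, 0; 0, 0, 0, 1], ?_, ?_⟩
      · rw [det4, isUnit_iff_ne_zero]
        intro h; have := mul_ne_zero n2 (mul_ne_zero (mul_ne_zero hb hc) hc); apply this; linear_combination h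
      · iterate 2 right
        left
        exact ⟨TT_mem H ((0)^2) ((c)^2) ((-f+β)^2) (2*(0)*(c)) (2*(0)*(-f+β)) (2*(c)*(-f+β))
          (by ring) (by linear_combination c * hβ) (fun s => by simp [eval_chg', mv]; try ring),
          TT_mem H ((-1*(0))^2) ((-1*(c))^2) ((-1*(-f-β))^2) (2*(-1*(0))*(-1*(c))) (2*(-1*(0))*(-1*(-f-β))) (2*(-1*(c))*(-1*(-f-β)))
          (by ring) (by linear_combination c * hβ) (fun s => by simp [eval_chg', mv]; try ring),
          TT_mem H ((c)^2) ((0)^2) ((-e)^2) (2*(c)*(0)) (2*(c)*(-e)) (2*(0)*(-e))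
          (by ring) (by linear_combination c * hα) (fun s => by simp [eval_chg', mv]; try ring),
          TT_mem H (((0)*(c))+((-1*(0))*(c))) (((c)*(0))+((-1*(c))*(0))) (((-f+β)*(-e))+((-1*(-f-β))*(-e))) (((0)*(0)+(c)*(c))+((-1*(0))*(0)+(-1*(c))*(c))) (((0)*(-e)+(-f+β)*(c))+((-1*(0))*(-e)+(-1*(-f-β))*(c))) (((c)*(-e)+(-f+β)*(0))+((-1*(c))*(-e)+(-1*(-f-β))*(0)))
          (by ring) (by ring) (fun s => by simp [eval_chg', mv]; try ring)⟩
  · by_cases hb : β = 0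
    · subst hb
      refine ⟨!![c, 0, -e+α, 0; -1*(c), -1*(0), -1*(-e-α), 0; 0, c, -f, 0; 0, 0, 0, 1], ?_, ?_⟩
      · rw [det4, isUnit_iff_ne_zero]
        intro h; have := mul_ne_zero n2 (mul_ne_zero (mul_ne_zero ha hc) hc); apply this; linear_combination -h
      · iterate 2 right
        left
        exact ⟨TT_mem H ((c)^2) ((0)^2) ((-e+α)^2) (2*(c)*(0)) (2*(c)*(-e+α)) (2*(0)*(-e+α))
          (by ring) (by linear_combination c * hα) (fun s => by simp [eval_chg', mv]; try ring),
          TT_mem H ((-1*(c))^2) ((-1*(0))^2) ((-1*(-e-α))^2) (2*(-1*(c))*(-1*(0))) (2*(-1*(c))*(-1*(-e-α))) (2*(-1*(0))*(-1*(-e-α)))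
          (by ring) (by linear_combination c * hα) (fun s => by simp [eval_chg', mv]; try ring),
          TT_mem H ((0)^2) ((c)^2) ((-f)^2) (2*(0)*(c)) (2*(0)*(-f)) (2*(c)*(-f))
          (by ring) (by linear_combination c * hβ) (fun s => by simp [eval_chg', mv]; try ring),
          TT_mem H (((c)*(0))+((-1*(c))*(0))) (((0)*(c))+((-1*(0))*(c))) (((-e+α)*(-f))+((-1*(-e-α))*(-f))) (((c)*(c)+(0)*(0))+((-1*(c))*(c)+(-1*(0))*(0))) (((c)*(-f)+(-e+α)*(0))+((-1*(c))*(-f)+(-1*(-e-α))*(0))) (((0)*(-f)+(-e+α)*(c))+((-1*(0))*(-f)+(-1*(-e-α))*(c)))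
          (by ring) (by ring) (fun s => by simp [eval_chg', mv]; try ring)⟩
    · refine ⟨!![α*(0), α*(c), α*(-f+β), 0; -β*(c), -β*(0), -β*(-e+α), 0; β*(c), β*(0), β*(-e-α), 0; 0, 0, 0, 1], ?_, ?_⟩
      · rw [det4, isUnit_iff_ne_zero]
        intro h; have := mul_ne_zero n2 (mul_ne_zero (mul_ne_zero (mul_ne_zero ha ha) (mul_ne_zero hb hb)) (mul_ne_zero hc hc)); apply this; linear_combination -h
      · iterate 1 right
        left
        exact ⟨TT_mem H ((α*(0))^2) ((α*(c))^2) ((α*(-f+β))^2) (2*(α*(0))*(α*(c))) (2*(α*(0))*(α*(-f+β))) (2*(α*(c))*(α*(-f+β)))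
          (by ring) (by linear_combination α ^ 2 * c * hβ) (fun s => by simp [eval_chg', mv]; try ring),
          TT_mem H ((-β*(c))^2) ((-β*(0))^2) ((-β*(-e+α))^2) (2*(-β*(c))*(-β*(0))) (2*(-β*(c))*(-β*(-e+α))) (2*(-β*(0))*(-β*(-e+α)))
          (by ring) (by linear_combination β ^ 2 * c * hα) (fun s => by simp [eval_chg', mv]; try ring),
          TT_mem H ((β*(c))^2) ((β*(0))^2) ((β*(-e-α))^2) (2*(β*(c))*(β*(0))) (2*(β*(c))*(β*(-e-α))) (2*(β*(0))*(β*(-e-α)))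
          (by ring) (by linear_combination β ^ 2 * c * hα) (fun s => by simp [eval_chg', mv]; try ring),
          TT_mem H (((α*(0))*(-β*(c)))+((α*(0))*(β*(c)))+((-β*(c))*(β*(c)))) (((α*(c))*(-β*(0)))+((α*(c))*(β*(0)))+((-β*(0))*(β*(0)))) (((α*(-f+β))*(-β*(-e+α)))+((α*(-f+β))*(β*(-e-α)))+((-β*(-e+α))*(β*(-e-α)))) (((α*(0))*(-β*(0))+(α*(c))*(-β*(c)))+((α*(0))*(β*(0))+(α*(c))*(β*(c)))+((-β*(c))*(β*(0))+(-β*(0))*(β*(c)))) (((α*(0))*(-β*(-e+α))+(α*(-f+β))*(-β*(c)))+((α*(0))*(β*(-e-α))+(α*(-f+β))*(β*(c)))+((-β*(c))*(β*(-e-α))+(-β*(-e+α))*(β*(c)))) (((α*(c))*(-β*(-e+α))+(α*(-f+β))*(-β*(0)))+((α*(c))*(β*(-e-α))+(α*(-f+β))*(β*(0)))+((-β*(0))*(β*(-e-α))+(-β*(-e+α))*(β*(0))))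
          (by ring) (by linear_combination (-1) * β ^ 2 * c * hα) (fun s => by simp [eval_chg', mv]; try ring)⟩

theorem XY_0 [IsAlgClosed K] {a b d e f : K} 
    (hI : IndP (sm 0 0 0 (1 / 2) 0 0) (sm a b 0 d e f)) :
    PG (sm 0 0 0 (1 / 2) 0 0) (sm a b 0 d e f) := by
  intro V H
  have n2 : (2 : K) ≠ 0 := two_ne_zero
  by_cases he : e = 0
  · by_cases hf : f = 0
    · subst he hf
      by_cases ha : a = 0
      · by_cases hb : b = 0
        · exfalso
          have := (hI (-2 * d) 1 (by
            subst ha hb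
            ext i j; fin_cases i <;> fin_cases j <;> simp [sm] <;> field_simp <;> ring)).2
          exact one_ne_zero this
        · subst ha
          refine ⟨!![0, 0, 1, 0; 1, 0, 0, 0; 0, 1, 0, 0; 0, 0, 0, 1], ?_, ?_⟩
          · rw [det4, isUnit_iff_ne_zero]
            simp
          · iterate 11 right
            exact ⟨TT_mem H ((0)^2) ((0)^2) ((1)^2) (2*(0)*(0)) (2*(0)*(1)) (2*(0)*(1))
              (by ring) (by ring) (fun s => by simp [eval_chg', mv]; try ring),
              TT_mem H ((0)*(1)) ((0)*(0)) ((1)*(0)) ((0)*(0)+(0)*(1)) ((0)*(0)+(1)*(1)) ((0)*(0)+(1)*(0))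
              (by ring) (by ring) (fun s => by simp [eval_chg', mv]; try ring),
              TT_mem H ((1)^2) ((0)^2) ((0)^2) (2*(1)*(0)) (2*(1)*(0)) (2*(0)*(0))
              (by ring) (by ring) (fun s => by simp [eval_chg', mv]; try ring),
              TT_mem H ((0)*(0)) ((0)*(1)) ((1)*(0)) ((0)*(1)+(0)*(0)) ((0)*(0)+(1)*(0)) ((0)*(0)+(1)*(1))
              (by ring) (by ring) (fun s => by simp [eval_chg', mv]; try ring)⟩
      · by_cases hb : b = 0
        · subst hb
          refine ⟨!![0, 0, 1, 0; 0, 1, 0, 0; 1, 0, 0, 0; 0, 0, 0, 1], ?_, ?_⟩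
          · rw [det4, isUnit_iff_ne_zero]
            simp
          · iterate 11 right
            exact ⟨TT_mem H ((0)^2) ((0)^2) ((1)^2) (2*(0)*(0)) (2*(0)*(1)) (2*(0)*(1))
              (by ring) (by ring) (fun s => by simp [eval_chg', mv]; try ring),
              TT_mem H ((0)*(0)) ((0)*(1)) ((1)*(0)) ((0)*(1)+(0)*(0)) ((0)*(0)+(1)*(0)) ((0)*(0)+(1)*(1))
              (by ring) (by ring) (fun s => by simp [eval_chg', mv]; try ring),
              TT_mem H ((0)^2) ((1)^2) ((0)^2) (2*(0)*(1)) (2*(0)*(0)) (2*(1)*(0))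
              (by ring) (by ring) (fun s => by simp [eval_chg', mv]; try ring),
              TT_mem H ((0)*(1)) ((0)*(0)) ((1)*(0)) ((0)*(0)+(0)*(1)) ((0)*(0)+(1)*(1)) ((0)*(0)+(1)*(0))
              (by ring) (by ring) (fun s => by simp [eval_chg', mv]; try ring)⟩
        · obtain ⟨μ, hμ⟩ := IsAlgClosed.exists_pow_nat_eq (b / a) (n := 2) (by norm_num)
          have hμ2 : a * μ ^ 2 = b := by rw [hμ]; field_simp
          have hμ0 : μ ≠ 0 := by rintro rfl; apply hb; rw [← hμ2]; ring
          refine ⟨!![0, 0, 1, 0; μ, 1, 0, 0; μ, -1, 0, 0; 0, 0, 0, 1], ?_, ?_⟩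
          · rw [det4, isUnit_iff_ne_zero]
            intro h; apply mul_ne_zero n2 hμ0; linear_combination -h
          · iterate 6 right
            left
            exact ⟨TT_mem H ((0)^2) ((0)^2) ((1)^2) (2*(0)*(0)) (2*(0)*(1)) (2*(0)*(1))
              (by ring) (by ring) (fun s => by simp [eval_chg', mv]; try ring),
              TT_mem H ((0)*(μ)) ((0)*(1)) ((1)*(0)) ((0)*(1)+(0)*(μ)) ((0)*(0)+(1)*(μ)) ((0)*(0)+(1)*(1))
              (by ring) (by ring) (fun s => by simp [eval_chg', mv]; try ring),
              TT_mem H ((0)*(μ)) ((0)*(-1)) ((1)*(0)) ((0)*(-1)+(0)*(μ)) ((0)*(0)+(1)*(μ)) ((0)*(0)+(1)*(-1))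
              (by ring) (by ring) (fun s => by simp [eval_chg', mv]; try ring),
              TT_mem H ((μ)*(μ)) ((1)*(-1)) ((0)*(0)) ((μ)*(-1)+(1)*(μ)) ((μ)*(0)+(0)*(μ)) ((1)*(0)+(0)*(-1))
              (by ring) (by linear_combination hμ2) (fun s => by simp [eval_chg', mv]; try ring)⟩
    · subst he
      by_cases ha : a = 0
      · subst ha
        refine ⟨!![1, 0, 0, 0; 0, 0, 1, 0; 0, 2*f, -b, 0; 0, 0, 0, 1], ?_, ?_⟩
        · rw [det4, isUnit_iff_ne_zero]
          simp [hf]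
        · iterate 9 right
          left
          exact ⟨TT_mem H ((1)^2) ((0)^2) ((0)^2) (2*(1)*(0)) (2*(1)*(0)) (2*(0)*(0))
            (by ring) (by ring) (fun s => by simp [eval_chg', mv]; try ring),
            TT_mem H ((1)*(0)) ((0)*(0)) ((0)*(1)) ((1)*(0)+(0)*(0)) ((1)*(1)+(0)*(0)) ((0)*(1)+(0)*(0))
            (by ring) (by ring) (fun s => by simp [eval_chg', mv]; try ring),
            TT_mem H ((0)^2) ((0)^2) ((1)^2) (2*(0)*(0)) (2*(0)*(1)) (2*(0)*(1))
            (by ring) (by ring) (fun s => by simp [eval_chg', mv]; try ring),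
            TT_mem H ((0)^2) ((2*f)^2) ((-b)^2) (2*(0)*(2*f)) (2*(0)*(-b)) (2*(2*f)*(-b))
            (by ring) (by ring) (fun s => by simp [eval_chg', mv]; try ring)⟩
      · refine ⟨!![0, 0, 1, 0; 1, 0, 0, 0; (a/(2*f^2))*(0), (a/(2*f^2))*(2*f), (a/(2*f^2))*(-b), 0; 0, 0, 0, 1], ?_, ?_⟩
        · rw [det4, isUnit_iff_ne_zero]
          simp [hf, ha]
        · iterate 3 right
          left
          exact ⟨TT_mem H ((0)^2) ((0)^2) ((1)^2) (2*(0)*(0)) (2*(0)*(1)) (2*(0)*(1))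
            (by ring) (by ring) (fun s => by simp [eval_chg', mv]; try ring),
            TT_mem H ((0)*(1)) ((0)*(0)) ((1)*(0)) ((0)*(0)+(0)*(1)) ((0)*(0)+(1)*(1)) ((0)*(0)+(1)*(0))
            (by ring) (by ring) (fun s => by simp [eval_chg', mv]; try ring),
            TT_mem H (((0)*((a/(2*f^2))*(0)))+(-((1)^2))) (((0)*((a/(2*f^2))*(2*f)))+(-((0)^2))) (((1)*((a/(2*f^2))*(-b)))+(-((0)^2))) (((0)*((a/(2*f^2))*(2*f))+(0)*((a/(2*f^2))*(0)))+(-(2*(1)*(0)))) (((0)*((a/(2*f^2))*(-b))+(1)*((a/(2*f^2))*(0)))+(-(2*(1)*(0)))) (((0)*((a/(2*f^2))*(-b))+(1)*((a/(2*f^2))*(2*f)))+(-(2*(0)*(0))))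
            (by ring) (by field_simp; ring) (fun s => by simp [eval_chg', mv]; try ring),
            TT_mem H (((a/(2*f^2))*(0))^2) (((a/(2*f^2))*(2*f))^2) (((a/(2*f^2))*(-b))^2) (2*((a/(2*f^2))*(0))*((a/(2*f^2))*(2*f))) (2*((a/(2*f^2))*(0))*((a/(2*f^2))*(-b))) (2*((a/(2*f^2))*(2*f))*((a/(2*f^2))*(-b)))
            (by ring) (by ring) (fun s => by simp [eval_chg', mv]; try ring)⟩
  · by_cases hf : f = 0
    · subst hf
      by_cases hb : b = 0
      · subst hb
        refine ⟨!![0, 1, 0, 0; 0, 0, 1, 0; 2*e, 0, -a, 0; 0, 0, 0, 1], ?_, ?_⟩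
        · rw [det4, isUnit_iff_ne_zero]
          simp [he]
        · iterate 9 right
          left
          exact ⟨TT_mem H ((0)^2) ((1)^2) ((0)^2) (2*(0)*(1)) (2*(0)*(0)) (2*(1)*(0))
            (by ring) (by ring) (fun s => by simp [eval_chg', mv]; try ring),
            TT_mem H ((0)*(0)) ((1)*(0)) ((0)*(1)) ((0)*(0)+(1)*(0)) ((0)*(1)+(0)*(0)) ((1)*(1)+(0)*(0))
            (by ring) (by ring) (fun s => by simp [eval_chg', mv]; try ring),
            TT_mem H ((0)^2) ((0)^2) ((1)^2) (2*(0)*(0)) (2*(0)*(1)) (2*(0)*(1))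
            (by ring) (by ring) (fun s => by simp [eval_chg', mv]; try ring),
            TT_mem H ((2*e)^2) ((0)^2) ((-a)^2) (2*(2*e)*(0)) (2*(2*e)*(-a)) (2*(0)*(-a))
            (by ring) (by ring) (fun s => by simp [eval_chg', mv]; try ring)⟩
      · refine ⟨!![0, 0, 1, 0; 0, 1, 0, 0; (b/(2*e^2))*(2*e), (b/(2*e^2))*(0), (b/(2*e^2))*(-a), 0; 0, 0, 0, 1], ?_, ?_⟩
        · rw [det4, isUnit_iff_ne_zero]
          simp [he, hb]
        · iterate 3 right
          left
          exact ⟨TT_mem H ((0)^2) ((0)^2) ((1)^2) (2*(0)*(0)) (2*(0)*(1)) (2*(0)*(1))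
            (by ring) (by ring) (fun s => by simp [eval_chg', mv]; try ring),
            TT_mem H ((0)*(0)) ((0)*(1)) ((1)*(0)) ((0)*(1)+(0)*(0)) ((0)*(0)+(1)*(0)) ((0)*(0)+(1)*(1))
            (by ring) (by ring) (fun s => by simp [eval_chg', mv]; try ring),
            TT_mem H (((0)*((b/(2*e^2))*(2*e)))+(-((0)^2))) (((0)*((b/(2*e^2))*(0)))+(-((1)^2))) (((1)*((b/(2*e^2))*(-a)))+(-((0)^2))) (((0)*((b/(2*e^2))*(0))+(0)*((b/(2*e^2))*(2*e)))+(-(2*(0)*(1)))) (((0)*((b/(2*e^2))*(-a))+(1)*((b/(2*e^2))*(2*e)))+(-(2*(0)*(0)))) (((0)*((b/(2*e^2))*(-a))+(1)*((b/(2*e^2))*(0)))+(-(2*(1)*(0))))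
            (by ring) (by field_simp; ring) (fun s => by simp [eval_chg', mv]; try ring),
            TT_mem H (((b/(2*e^2))*(2*e))^2) (((b/(2*e^2))*(0))^2) (((b/(2*e^2))*(-a))^2) (2*((b/(2*e^2))*(2*e))*((b/(2*e^2))*(0))) (2*((b/(2*e^2))*(2*e))*((b/(2*e^2))*(-a))) (2*((b/(2*e^2))*(0))*((b/(2*e^2))*(-a)))
            (by ring) (by ring) (fun s => by simp [eval_chg', mv]; try ring)⟩
    · refine ⟨!![f^2*(2*e), f^2*(0), f^2*(-a), 0; -e^2*(0), -e^2*(2*f), -e^2*(-b), 0; 0, 0, 1, 0; 0, 0, 0, 1], ?_, ?_⟩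
      · rw [det4, isUnit_iff_ne_zero]
        simp [he, hf]
      · iterate 2 right
        left
        exact ⟨TT_mem H ((f^2*(2*e))^2) ((f^2*(0))^2) ((f^2*(-a))^2) (2*(f^2*(2*e))*(f^2*(0))) (2*(f^2*(2*e))*(f^2*(-a))) (2*(f^2*(0))*(f^2*(-a)))
          (by ring) (by ring) (fun s => by simp [eval_chg', mv]; try ring),
          TT_mem H ((-e^2*(0))^2) ((-e^2*(2*f))^2) ((-e^2*(-b))^2) (2*(-e^2*(0))*(-e^2*(2*f))) (2*(-e^2*(0))*(-e^2*(-b))) (2*(-e^2*(2*f))*(-e^2*(-b)))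
          (by ring) (by ring) (fun s => by simp [eval_chg', mv]; try ring),
          TT_mem H ((0)^2) ((0)^2) ((1)^2) (2*(0)*(0)) (2*(0)*(1)) (2*(0)*(1))
          (by ring) (by ring) (fun s => by simp [eval_chg', mv]; try ring),
          TT_mem H (((f^2*(2*e))*(0))+((-e^2*(0))*(0))) (((f^2*(0))*(0))+((-e^2*(2*f))*(0))) (((f^2*(-a))*(1))+((-e^2*(-b))*(1))) (((f^2*(2*e))*(0)+(f^2*(0))*(0))+((-e^2*(0))*(0)+(-e^2*(2*f))*(0))) (((f^2*(2*e))*(1)+(f^2*(-a))*(0))+((-e^2*(0))*(1)+(-e^2*(-b))*(0))) (((f^2*(0))*(1)+(f^2*(-a))*(0))+((-e^2*(2*f))*(1)+(-e^2*(-b))*(0)))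
          (by ring) (by ring) (fun s => by simp [eval_chg', mv]; try ring)⟩

theorem XX2 {a d e f : K} (hf : f ≠ 0) :
    PG (sm 1 0 0 0 0 0) (sm a 0 0 d e f) := by
  intro V H
  refine ⟨!![0, 1, 0, 0; 0, 0, 1, 0; f, -e, -d, 0; 0, 0, 0, 1], ?_, ?_⟩
  · rw [det4, isUnit_iff_ne_zero]
    simp [hf]
  · iterate 5 right
    left
    exact ⟨TT_mem H ((0)^2) ((1)^2) ((0)^2) (2*(0)*(1)) (2*(0)*(0)) (2*(1)*(0))
      (by ring) (by ring) (fun s => by simp [eval_chg', mv]; try ring),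
      TT_mem H ((0)*(f)) ((1)*(-e)) ((0)*(-d)) ((0)*(-e)+(1)*(f)) ((0)*(-d)+(0)*(f)) ((1)*(-d)+(0)*(-e))
      (by ring) (by ring) (fun s => by simp [eval_chg', mv]; try ring),
      TT_mem H ((0)^2) ((0)^2) ((1)^2) (2*(0)*(0)) (2*(0)*(1)) (2*(0)*(1))
      (by ring) (by ring) (fun s => by simp [eval_chg', mv]; try ring),
      TT_mem H ((0)*(f)) ((0)*(-e)) ((1)*(-d)) ((0)*(-e)+(0)*(f)) ((0)*(-d)+(1)*(f)) ((0)*(-d)+(1)*(-e))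
      (by ring) (by ring) (fun s => by simp [eval_chg', mv]; try ring)⟩

theorem XX1 {a d e : K} :
    PG (sm 1 0 0 0 0 0) (sm a 1 0 d e 0) := by
  intro V H
  by_cases he : e = 0
  · subst he
    refine ⟨!![0, 0, 1, 0; 0, 1, 0, 0; 1, -d, 0, 0; 0, 0, 0, 1], ?_, ?_⟩
    · rw [det4, isUnit_iff_ne_zero]
      simp
    · iterate 6 right
      left
      exact ⟨TT_mem H ((0)^2) ((0)^2) ((1)^2) (2*(0)*(0)) (2*(0)*(1)) (2*(0)*(1))
        (by ring) (by ring) (fun s => by simp [eval_chg', mv]; try ring),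
        TT_mem H ((0)*(0)) ((0)*(1)) ((1)*(0)) ((0)*(1)+(0)*(0)) ((0)*(0)+(1)*(0)) ((0)*(0)+(1)*(1))
        (by ring) (by ring) (fun s => by simp [eval_chg', mv]; try ring),
        TT_mem H ((0)*(1)) ((0)*(-d)) ((1)*(0)) ((0)*(-d)+(0)*(1)) ((0)*(0)+(1)*(1)) ((0)*(0)+(1)*(-d))
        (by ring) (by ring) (fun s => by simp [eval_chg', mv]; try ring),
        TT_mem H ((0)*(1)) ((1)*(-d)) ((0)*(0)) ((0)*(-d)+(1)*(1)) ((0)*(0)+(0)*(1)) ((1)*(0)+(0)*(-d))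
        (by ring) (by ring) (fun s => by simp [eval_chg', mv]; try ring)⟩
  · refine ⟨!![0, 0, 1, 0; 0, 1, 0, 0; 1/e, -d/e, 0, 0; 0, 0, 0, 1], ?_, ?_⟩
    · rw [det4, isUnit_iff_ne_zero]
      simp [he]
    · iterate 4 right
      left
      exact ⟨TT_mem H ((0)^2) ((0)^2) ((1)^2) (2*(0)*(0)) (2*(0)*(1)) (2*(0)*(1))
        (by ring) (by ring) (fun s => by simp [eval_chg', mv]; try ring),
        TT_mem H ((0)*(0)) ((0)*(1)) ((1)*(0)) ((0)*(1)+(0)*(0)) ((0)*(0)+(1)*(0)) ((0)*(0)+(1)*(1))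
        (by ring) (by ring) (fun s => by simp [eval_chg', mv]; try ring),
        TT_mem H (((0)*(1/e))+(-((0)^2))) (((0)*(-d/e))+(-((1)^2))) (((1)*(0))+(-((0)^2))) (((0)*(-d/e)+(0)*(1/e))+(-(2*(0)*(1)))) (((0)*(0)+(1)*(1/e))+(-(2*(0)*(0)))) (((0)*(0)+(1)*(-d/e))+(-(2*(1)*(0))))
        (by ring) (by field_simp; try ring) (fun s => by simp [eval_chg', mv]; try ring),
        TT_mem H ((0)*(1/e)) ((1)*(-d/e)) ((0)*(0)) ((0)*(-d/e)+(1)*(1/e)) ((0)*(0)+(0)*(1/e)) ((1)*(0)+(0)*(-d/e))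
        (by ring) (by ring) (fun s => by simp [eval_chg', mv]; try ring)⟩

theorem XX0 {a d e : K} (h : ¬ (d = 0 ∧ e = 0)) :
    PG (sm 1 0 0 0 0 0) (sm a 0 0 d e 0) := by
  intro V H
  by_cases he : e = 0
  · have hd : d ≠ 0 := fun hd => h ⟨hd, he⟩
    subst he
    refine ⟨!![0, 0, -d, 0; 0, 1, 0, 0; 1, 0, 0, 0; 0, 0, 0, 1], ?_, ?_⟩
    · rw [det4, isUnit_iff_ne_zero]
      simp [hd]
    · iterate 11 right
      exact ⟨TT_mem H ((0)^2) ((0)^2) ((-d)^2) (2*(0)*(0)) (2*(0)*(-d)) (2*(0)*(-d))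
        (by ring) (by ring) (fun s => by simp [eval_chg', mv]; try ring),
        TT_mem H ((0)*(0)) ((0)*(1)) ((-d)*(0)) ((0)*(1)+(0)*(0)) ((0)*(0)+(-d)*(0)) ((0)*(0)+(-d)*(1))
        (by ring) (by ring) (fun s => by simp [eval_chg', mv]; try ring),
        TT_mem H ((0)^2) ((1)^2) ((0)^2) (2*(0)*(1)) (2*(0)*(0)) (2*(1)*(0))
        (by ring) (by ring) (fun s => by simp [eval_chg', mv]; try ring),
        TT_mem H ((0)*(1)) ((0)*(0)) ((-d)*(0)) ((0)*(0)+(0)*(1)) ((0)*(0)+(-d)*(1)) ((0)*(0)+(-d)*(0))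
        (by ring) (by ring) (fun s => by simp [eval_chg', mv]; try ring)⟩
  · refine ⟨!![0, e, -d, 0; 0, 0, 1, 0; 1, 0, 0, 0; 0, 0, 0, 1], ?_, ?_⟩
    · rw [det4, isUnit_iff_ne_zero]
      simp [he]
    · iterate 11 right
      exact ⟨TT_mem H ((0)^2) ((e)^2) ((-d)^2) (2*(0)*(e)) (2*(0)*(-d)) (2*(e)*(-d))
        (by ring) (by ring) (fun s => by simp [eval_chg', mv]; try ring),
        TT_mem H ((0)*(0)) ((e)*(0)) ((-d)*(1)) ((0)*(0)+(e)*(0)) ((0)*(1)+(-d)*(0)) ((e)*(1)+(-d)*(0))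
        (by ring) (by ring) (fun s => by simp [eval_chg', mv]; try ring),
        TT_mem H ((0)^2) ((0)^2) ((1)^2) (2*(0)*(0)) (2*(0)*(1)) (2*(0)*(1))
        (by ring) (by ring) (fun s => by simp [eval_chg', mv]; try ring),
        TT_mem H ((0)*(1)) ((e)*(0)) ((-d)*(0)) ((0)*(0)+(e)*(1)) ((0)*(0)+(-d)*(1)) ((e)*(0)+(-d)*(0))
        (by ring) (by ring) (fun s => by simp [eval_chg', mv]; try ring)⟩
end four
end

section

section five
variable {K : Type*} [Field K] [CharZero K]

theorem XX_all [IsAlgClosed K] {a b c d e f : K}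
    (hI : IndP (sm 1 0 0 0 0 0) (sm a b c d e f)) :
    PG (sm 1 0 0 0 0 0) (sm a b c d e f) := by
  obtain ⟨p, q, r, s, hdet, H⟩ := bin b (2 * f) c
  have hu : IsUnit (!![1, 0, 0; 0, p, r; 0, q, s] : Matrix (Fin 3) (Fin 3) K).det := by
    rw [Matrix.det_fin_three, isUnit_iff_ne_zero]
    simp
    intro h; apply hdet; linear_combination h
  have e1 : !![1, 0, 0; 0, p, r; 0, q, s] * sm 1 0 0 0 0 0 *
      (!![1, 0, 0; 0, p, r; 0, q, s] : Matrix (Fin 3) (Fin 3) K).transpose = sm 1 0 0 0 0 0 := by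
    ext i j
    fin_cases i <;> fin_cases j <;> simp [sm, Matrix.mul_apply, Fin.sum_univ_three]
  have e2 : !![1, 0, 0; 0, p, r; 0, q, s] * sm a b c d e f *
      (!![1, 0, 0; 0, p, r; 0, q, s] : Matrix (Fin 3) (Fin 3) K).transpose =
      sm a (b * p ^ 2 + 2 * f * p * r + c * r ^ 2) (b * q ^ 2 + 2 * f * q * s + c * s ^ 2)
        (p * d + r * e) (q * d + s * e)
        ((2 * b * p * q + 2 * f * (p * s + q * r) + 2 * c * r * s) / 2) := by
    ext i j
    fin_cases i <;> fin_cases j <;> simp [sm, Matrix.mul_apply, Fin.sum_univ_three] <;> ring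
  rcases H with ⟨h1, h2, h3⟩ | ⟨h1, h2, h3⟩ | ⟨h1, h2, h3⟩
  · apply PG_congr hu
    rw [e1, e2, h1, h2, h3]
    exact XX2 (by simp)
  · apply PG_congr hu
    rw [e1, e2, h1, h2, h3, zero_div]
    exact XX1
  · have hf : f = 0 := by simpa using h2
    subst h1 h3 hf
    apply XX0
    rintro ⟨rfl, rfl⟩
    have := (hI (-a) 1 (by
            ext i j; fin_cases i <;> fin_cases j <;> simp [sm])).2
    exact one_ne_zero this

theorem pencil_sing [IsAlgClosed K] {D Q : Matrix (Fin 3) (Fin 3) K} (hD : D.IsSymm)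
    (hQ : Q.IsSymm) (hI : IndP D Q) (hd : D.det = 0) : PG D Q := by
  have h0 : D ≠ 0 := by
    rintro rfl
    exact one_ne_zero (hI 1 0 (by simp)).1
  obtain ⟨h, hu, H⟩ := sing_red hD h0 hd
  apply PG_congr hu
  have hI' := IndP_congr hu hI
  rw [sm_of (symm_congr (h := h) hQ)] at hI' ⊢
  generalize (h * Q * h.transpose) 0 0 = a at *
  generalize (h * Q * h.transpose) 1 1 = b at *
  generalize (h * Q * h.transpose) 2 2 = c at *
  generalize (h * Q * h.transpose) 0 1 = d at *
  generalize (h * Q * h.transpose) 0 2 = e at *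
  generalize (h * Q * h.transpose) 1 2 = f at *
  rcases H with H | H
  · rw [H] at hI' ⊢
    by_cases hc : c = 0
    · subst hc
      exact XY_0 hI'
    · exact XY_c hc
  · rw [H] at hI' ⊢
    exact XX_all hI'

theorem pencil [IsAlgClosed K] {D Q : Matrix (Fin 3) (Fin 3) K} (hD : D.IsSymm)
    (hQ : Q.IsSymm) (hI : IndP D Q) : PG D Q := by
  by_cases hq : Q.det = 0
  · apply PG_swap
    refine pencil_sing hQ hD ?_ hq
    intro s t h
    exact (hI t s (by rw [add_comm]; exact h)).symm
  · have hqu : IsUnit Q.det := isUnit_iff_ne_zero.mpr hq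
    obtain ⟨t, ht⟩ := IsAlgClosed.exists_root (Q⁻¹ * D).charpoly (by
      rw [Matrix.charpoly_degree_eq_dim]; simp)
    apply PG_sub t
    refine pencil_sing ?_ hQ ?_ ?_
    · exact (hQ.smul t).sub hD
    · intro a b h
      have := hI (-a) (a * t + b) (by
        rw [← h]
        module)
      have ha : a = 0 := by simpa using this.1
      refine ⟨ha, by simpa [ha] using this.2⟩
    · rw [Polynomial.IsRoot, Matrix.eval_charpoly] at ht
      have : t • Q - D = Q * (Matrix.scalar (Fin 3) t - Q⁻¹ * D) := by
        rw [Matrix.mul_sub, ← Matrix.mul_assoc, Matrix.mul_nonsing_inv Q hqu, Matrix.one_mul]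
        congr 1
        ext i j
        simp [mul_comm]
      rw [this, Matrix.det_mul, ht, mul_zero]

/-- Ternary spaces given by explicit independent functionals are good. -/
theorem ternary [IsAlgClosed K] {a b c d e f a' b' c' d' e' f' : K} {V : Submodule K (PP K)}
    (hI : ∀ s t : K, s * a + t * a' = 0 → s * b + t * b' = 0 → s * c + t * c' = 0 →
      s * d + t * d' = 0 → s * e + t * e' = 0 → s * f + t * f' = 0 → s = 0 ∧ t = 0)
    (H : ∀ x y z u v w : K, a * x + b * y + c * z + d * u + e * v + f * w = 0 →
      a' * x + b' * y + c' * z + d' * u + e' * v + f' * w = 0 →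
      ∃ p ∈ V, ∀ s : Fin 4 → K, eval s p = x * s 0 ^ 2 + y * s 1 ^ 2 + z * s 2 ^ 2
        + u * (s 0 * s 1) + v * (s 0 * s 2) + w * (s 1 * s 2)) : Good V := by
  refine pencil ?_ ?_ ?_ V (TT_mk H)
  · ext i j; fin_cases i <;> fin_cases j <;> rfl
  · ext i j; fin_cases i <;> fin_cases j <;> rfl
  · intro s t h
    have := fun i j => congrFun (congrFun h i) j
    refine hI s t ?_ ?_ ?_ ?_ ?_ ?_
    · simpa [sm] using this 0 0
    · simpa [sm] using this 1 1
    · simpa [sm] using this 2 2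
    · simpa [sm] using this 0 1
    · simpa [sm] using this 0 2
    · simpa [sm] using this 1 2
end five
end

section

section six
variable {K : Type*} [Field K] [CharZero K]

theorem uni (c0 c1 c2 c3 : K) (h : ∀ w : K, c0 + c1 * w + c2 * w ^ 2 + c3 * w ^ 3 = 0) :
    c0 = 0 ∧ c1 = 0 ∧ c2 = 0 ∧ c3 = 0 := by
  have h0 := h 0
  have h1 := h 1
  have h2 := h (-1)
  have h3 := h 2
  have e0 : c0 = 0 := by linear_combination h0
  have e2 : c2 = 0 := by linear_combination (h1 + h2) / 2 - h0
  have e3 : c3 = 0 := by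
    linear_combination (1 / 6 : K) * (h3 - 4 * e2 - e0 - (h1 - h2))
  have e1 : c1 = 0 := by linear_combination h1 - e0 - e2 - e3
  exact ⟨e0, e1, e2, e3⟩

theorem quadz (k1 k2 k3 k4 k5 k6 : K) (h : ∀ x y z : K, k1 * x ^ 2 + k2 * y ^ 2 + k3 * z ^ 2 +
    k4 * (x * y) + k5 * (x * z) + k6 * (y * z) = 0) :
    k1 = 0 ∧ k2 = 0 ∧ k3 = 0 ∧ k4 = 0 ∧ k5 = 0 ∧ k6 = 0 := by
  have e1 := h 1 0 0
  have e2 := h 0 1 0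
  have e3 := h 0 0 1
  have e4 := h 1 1 0
  have e5 := h 1 0 1
  have e6 := h 0 1 1
  refine ⟨?_, ?_, ?_, ?_, ?_, ?_⟩
  · linear_combination e1
  · linear_combination e2
  · linear_combination e3
  · linear_combination e4 - e1 - e2
  · linear_combination e5 - e1 - e3
  · linear_combination e6 - e2 - e3

theorem cubz (k1 k2 k3 k4 k5 k6 k7 k8 k9 k10 : K) (h : ∀ x y z : K,
    k1 * x ^ 3 + k2 * y ^ 3 + k3 * z ^ 3 +
    k4 * (x ^ 2 * y) + k5 * (x ^ 2 * z) + k6 * (x * y ^ 2) + k7 * (y ^ 2 * z) + k8 * (x * z ^ 2) +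
    k9 * (y * z ^ 2) + k10 * (x * y * z) = 0) :
    (k1 = 0 ∧ k2 = 0 ∧ k3 = 0) ∧ (k4 = 0 ∧ k5 = 0 ∧ k6 = 0) ∧ (k7 = 0 ∧ k8 = 0 ∧ k9 = 0 ∧
      k10 = 0) := by
  have e1 : k1 = 0 := by linear_combination h 1 0 0
  have e2 : k2 = 0 := by linear_combination h 0 1 0
  have e3 : k3 = 0 := by linear_combination h 0 0 1
  have e4 : k4 = 0 := by linear_combination (h 1 1 0 - h 1 (-1) 0) / 2 - e2
  have e6 : k6 = 0 := by linear_combination (h 1 1 0 + h 1 (-1) 0) / 2 - e1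
  have e5 : k5 = 0 := by linear_combination (h 1 0 1 - h 1 0 (-1)) / 2 - e3
  have e8 : k8 = 0 := by linear_combination (h 1 0 1 + h 1 0 (-1)) / 2 - e1
  have e7 : k7 = 0 := by linear_combination (h 0 1 1 - h 0 1 (-1)) / 2 - e3
  have e9 : k9 = 0 := by linear_combination (h 0 1 1 + h 0 1 (-1)) / 2 - e2
  have e10 : k10 = 0 := by
    linear_combination h 1 1 1 - e1 - e2 - e3 - e4 - e5 - e6 - e7 - e8 - e9
  exact ⟨⟨e1, e2, e3⟩, ⟨e4, e5, e6⟩, ⟨e7, e8, e9, e10⟩⟩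

/-- quadric in `X1, X2, X3` -/
def qq (a b c d e f : K) : PP K :=
  C a * X 1 ^ 2 + C b * (X 1 * X 2) + C c * X 2 ^ 2 + C d * (X 1 * X 3) + C e * (X 2 * X 3) +
    C f * X 3 ^ 2

variable {V : Submodule K (PP K)}

set_option maxHeartbeats 4000000 in
theorem jac_gen (hV : Module.finrank K V = 4) (hJ : JJ V)
    {a0 b0 c0 d0 e0 f0 a1 b1 c1 d1 e1 f1 a2 b2 c2 d2 e2 f2 a3 b3 c3 d3 e3 f3 : K}
    (m0 : qq a0 b0 c0 d0 e0 f0 ∈ V) (m1 : X 0 * X 1 + qq a1 b1 c1 d1 e1 f1 ∈ V)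
    (m2 : X 0 * X 2 + qq a2 b2 c2 d2 e2 f2 ∈ V) (m3 : X 0 ^ 2 + qq a3 b3 c3 d3 e3 f3 ∈ V)
    (hn : ¬ (a0 = 0 ∧ b0 = 0 ∧ c0 = 0 ∧ d0 = 0 ∧ e0 = 0 ∧ f0 = 0)) (w x y z : K) :
    (!![0, 2 * a0 * x + b0 * y + d0 * z, b0 * x + 2 * c0 * y + e0 * z,
          d0 * x + e0 * y + 2 * f0 * z;
        x, w + (2 * a1 * x + b1 * y + d1 * z), b1 * x + 2 * c1 * y + e1 * z,
          d1 * x + e1 * y + 2 * f1 * z;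
        y, 2 * a2 * x + b2 * y + d2 * z, w + (b2 * x + 2 * c2 * y + e2 * z),
          d2 * x + e2 * y + 2 * f2 * z;
        2 * w, 2 * a3 * x + b3 * y + d3 * z, b3 * x + 2 * c3 * y + e3 * z,
          d3 * x + e3 * y + 2 * f3 * z]).det = 0 := by
  have hli : LinearIndependent K ![qq a0 b0 c0 d0 e0 f0, X 0 * X 1 + qq a1 b1 c1 d1 e1 f1,
      X 0 * X 2 + qq a2 b2 c2 d2 e2 f2, X 0 ^ 2 + qq a3 b3 c3 d3 e3 f3] := by
    apply li_of
    intro a b c d h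
    have E : ∀ i j, hs i j _ = hs i j 0 := fun i j => congrArg (hs i j) h
    have t00 := E 0 0
    have t01 := E 0 1
    have t02 := E 0 2
    have t11 := E 1 1
    have t12 := E 1 2
    have t13 := E 1 3
    have t22 := E 2 2
    have t23 := E 2 3
    have t33 := E 3 3
    clear E
    simp [hs, qq, pderiv_X, cc2] at t00 t01 t02 
    simp [t00, t01, t02, hs, qq, pderiv_X, cc2] at t11 t12 t13 t22 t23 t33
    refine ⟨?_, t01, t02, t00⟩
    by_contra ha
    simp [ha] at t11 t12 t13 t22 t23 t33
    exact hn ⟨t11, t12, t22, t13, t23, t33⟩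
  have := jac_det hV hJ _ hli (by intro i; fin_cases i <;> assumption) ![w, x, y, z]
  refine Eq.trans ?_ this
  congr 1
  ext i j
  fin_cases i <;> fin_cases j <;> simp [qq, pderiv_X] <;> ring

theorem jac_coef {A B C' D E F G H I J L M x y : K}
    (h : ∀ w : K, (!![0, A, B, C'; x, w + D, E, F; y, G, w + H, I; 2 * w, J, L, M]).det = 0) :
    C' = 0 ∧ A * F + B * I = 0 ∧
      x * A * M + y * B * M + 2 * (A * (E * I - F * H) - B * (D * I - F * G)) = 0 ∧
      -x * (A * (H * M - I * L) - B * (G * M - I * J)) +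
        y * (A * (E * M - F * L) - B * (D * M - F * J)) = 0 := by
  obtain ⟨h0, h1, h2, h3⟩ := uni
    (-x * (A * (H * M - I * L) - B * (G * M - I * J) + C' * (G * L - H * J)) +
        y * (A * (E * M - F * L) - B * (D * M - F * J) + C' * (D * L - E * J)))
    (-x * (A * M - C' * J) - y * (B * M - C' * L) - 2 * (A * (E * I - F * H) - B * (D * I - F * G)
      + C' * (D * H - E * G)))
    (2 * A * F + 2 * B * I - 2 * C' * (D + H)) (-2 * C') (fun w => by
      have := h w
      rw [det4] at this
      linear_combination this)
  have hC : C' = 0 := by linear_combination -h3 / 2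
  subst hC
  refine ⟨rfl, ?_, ?_, ?_⟩
  · linear_combination h2 / 2
  · linear_combination -h1
  · linear_combination h0

theorem R2 [IsAlgClosed K] (hV : Module.finrank K V = 4) (hJ : JJ V)
    {a1 b1 c1 d1 e1 a2 b2 c2 d2 e2 a3 b3 c3 d3 e3 : K}
    (m0 : qq 0 1 0 0 0 0 ∈ V) (m1 : X 0 * X 1 + qq a1 0 b1 c1 d1 e1 ∈ V)
    (m2 : X 0 * X 2 + qq a2 0 b2 c2 d2 e2 ∈ V) (m3 : X 0 ^ 2 + qq a3 0 b3 c3 d3 e3 ∈ V) :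
    Good V := by
  have hj := fun x y z => jac_coef (fun w => jac_gen hV hJ m0 m1 m2 m3 (by simp) w x y z)
  obtain ⟨k1, k2, -, k4, k5, k6⟩ := quadz c2 d1 0 (c1 + d2) (2 * e2) (2 * e1) (fun x y z => by
    linear_combination (hj x y z).2.1)
  have n2 : (2 : K) ≠ 0 := two_ne_zero
  have k5' : e2 = 0 := by simpa using k5
  have k6' : e1 = 0 := by simpa using k6
  have k4' : d2 = -c1 := by linear_combination k4
  subst k1 k2 k5' k6' k4'
  obtain ⟨⟨l1, l2, -⟩, ⟨l4, -, l6⟩, ⟨-, -, -, l10⟩⟩ := cubz (4 * a2 * c1) (-4 * b1 * c1) 0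
    (2 * c3 + 4 * a1 * c1) 0 (2 * d3 - 4 * b2 * c1) 0 0 0 (4 * e3 + 4 * c1 ^ 2) (fun x y z => by
    linear_combination (hj x y z).2.2.1)
  have hc3 : c3 = -2 * a1 * c1 := by linear_combination l4 / 2
  have hd3 : d3 = 2 * b2 * c1 := by linear_combination l6 / 2
  have he3 : e3 = - c1 ^ 2 := by linear_combination l10 / 4
  subst hc3 hd3 he3
  by_cases hc : c1 = 0
  · subst hc
    refine ternary (a := -a3) (b := 1) (c := 0) (d := -a1) (e := -a2) (f := 0)
      (a' := -b3) (b' := 0) (c' := 1) (d' := -b1) (e' := -b2) (f' := 0) ?_ ?_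
    · intro s t _ h2 h3 _ _ _
      exact ⟨by simpa using h2, by simpa using h3⟩
    · intro x y z u v w h1 h2
      refine ⟨_, mem4 m3 m1 m2 m0 x u v w rfl, ?_⟩
      intro s
      simp [qq]
      linear_combination -s 1 ^ 2 * h1 - s 2 ^ 2 * h2
  · have ha2 : a2 = 0 := by simpa [hc] using l1
    have hb1 : b1 = 0 := by simpa [hc] using l2
    subst ha2 hb1
    have p1 := (hj 1 1 0).2.2.2
    have p2 := (hj 2 1 0).2.2.2
    have ha3 : a3 = - a1 ^ 2 := by
      apply mul_left_cancel₀ hc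
      linear_combination (p2 / 2 - p1) / 12
    have hb3 : b3 = - b2 ^ 2 := by
      apply mul_left_cancel₀ hc
      linear_combination -(4 * p1 - p2 / 2) / 12
    subst ha3 hb3
    refine ⟨!![0, 1, 0, 0; 1, 0, b2, -c1; 0, 0, 1, 0; 1, a1, 0, c1], ?_, ?_⟩
    · rw [det4, isUnit_iff_ne_zero]
      intro h; apply mul_ne_zero n2 hc; linear_combination -h
    · left
      refine ⟨mem4' m0 m1 m2 m3 1 0 0 0 ?_, mem4' m0 m1 m2 m3 0 1 0 0 ?_,
        mem4' m0 m1 m2 m3 0 0 1 0 ?_, mem4' m0 m1 m2 m3 (a1 * b2) a1 b2 1 ?_⟩ <;>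
      · intro x
        simp [eval_chg', mv, qq]
        try ring

theorem R1 [IsAlgClosed K] (hV : Module.finrank K V = 4) (hJ : JJ V)
    {a1 b1 c1 d1 e1 a2 b2 c2 d2 e2 a3 b3 c3 d3 e3 : K}
    (m0 : qq 1 0 0 0 0 0 ∈ V) (m1 : X 0 * X 1 + qq 0 a1 b1 c1 d1 e1 ∈ V)
    (m2 : X 0 * X 2 + qq 0 a2 b2 c2 d2 e2 ∈ V) (m3 : X 0 ^ 2 + qq 0 a3 b3 c3 d3 e3 ∈ V) :
    Good V := by
  have hj := fun x y z => jac_coef (fun w => jac_gen hV hJ m0 m1 m2 m3 (by simp) w x y z)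
  obtain ⟨k1, -, -, k4, k5, -⟩ := quadz (2 * c1) 0 0 (2 * d1) (4 * e1) 0 (fun x y z => by
    linear_combination (hj x y z).2.1)
  have n2 : (2 : K) ≠ 0 := two_ne_zero
  have k1' : c1 = 0 := by simpa using k1
  have k4' : d1 = 0 := by simpa using k4
  have k5' : e1 = 0 := by simpa using k5
  subst k1' k4' k5'
  obtain ⟨⟨l1, -, -⟩, ⟨l4, l5, l6⟩, ⟨-, -, -, l10⟩⟩ := cubz (2 * c3 + 4 * a1 * c2) 0 0
    (2 * d3 + 4 * a1 * d2 + 8 * b1 * c2) (4 * e3 + 8 * a1 * e2) (8 * b1 * d2) 0 0 0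
    (16 * b1 * e2) (fun x y z => by
    linear_combination (hj x y z).2.2.1)
  have hc3 : c3 = -2 * a1 * c2 := by linear_combination l1 / 2
  have hd3 : d3 = -2 * a1 * d2 - 4 * b1 * c2 := by linear_combination l4 / 2
  have he3 : e3 = -2 * a1 * e2 := by linear_combination l5 / 4
  subst hc3 hd3 he3
  have tern : b1 * c2 = 0 → c2 = 0 → d2 = 0 → e2 = 0 → Good V := by
    intro _ h2 h3 h4
    subst h2 h3 h4
    refine ternary (a := -b3) (b := 0) (c := 1) (d := -b1) (e := -b2) (f := 0)
      (a' := -a3) (b' := 0) (c' := 0) (d' := -a1) (e' := -a2) (f' := 1) ?_ ?_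
    · intro s t _ _ h3 _ _ h4
      exact ⟨by simpa using h3, by simpa using h4⟩
    · intro x y z u v w h1 h2
      refine ⟨_, mem4 m3 m1 m2 m0 x u v y rfl, ?_⟩
      intro s
      simp [qq]
      linear_combination -s 2 ^ 2 * h1 - s 1 * s 2 * h2
  by_cases hb : b1 = 0
  · subst hb
    have key : ∀ y z, (c2 + d2 * y + 2 * e2 * z) *
        ((2 * a1 * a2 + a3) + (4 * a1 * b2 + 2 * b3 - 2 * a1 ^ 2) * y) = 0 := by
      intro y z
      have := (hj 1 y z).2.2.2
      linear_combination this / 2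
    generalize hn1 : 2 * a1 * a2 + a3 = n1 at key
    generalize hnn : 4 * a1 * b2 + 2 * b3 - 2 * a1 ^ 2 = n2' at key
    have t1 : c2 * n1 = 0 := by linear_combination key 0 0
    have t2 : d2 * n2' = 0 := by linear_combination (key 1 0 + key (-1) 0) / 2 - key 0 0
    have t3 : c2 * n2' + d2 * n1 = 0 := by linear_combination (key 1 0 - key (-1) 0) / 2
    have t4 : e2 * n1 = 0 := by linear_combination (key 0 1 - key 0 0) / 2
    have t5 : e2 * n2' = 0 := by
      linear_combination (key 1 1 - key 1 0) / 2 - t4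
    by_cases hN : n1 = 0 ∧ n2' = 0
    · obtain ⟨rfl, rfl⟩ := hN
      have hg : IsUnit (!![0, 1, -a1, 0; 1, 0, 0, 0; 0, 0, 1, 0; 0, 0, 0, 1] :
          Matrix (Fin 4) (Fin 4) K).det := by
        rw [det4]; simp
      apply Good_of_mp hg
      refine BB (a := b2 - a1) (b := d2) (c := e2) (d := a2) (e := c2) (f := 1) (h := 0)
        (memchg m0 ?_) (memchg m1 ?_)
        (memchg (mem4 m0 m1 m2 m3 0 0 (2 * a1) 1 rfl) ?_) (memchg m2 ?_) (by simp)
      · intro x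
        simp [mv, qq]
      · intro x
        simp [mv, qq]
        ring
      · intro x
        simp [mv, qq]
        linear_combination -(x 0 * x 2) * hn1 - (x 2 ^ 2) * hnn / 2
      · intro x
        simp [mv, qq, qB]
        ring
    · have hc2 : c2 = 0 := by
        by_contra hc
        have h1 : n1 = 0 := by simpa [hc] using t1
        subst h1
        exact hN ⟨rfl, by simpa [hc] using t3⟩
      subst hc2
      have hd2 : d2 = 0 := by
        by_contra hc
        exact hN ⟨by simpa [hc] using t3, by simpa [hc] using t2⟩
      subst hd2
      have he2 : e2 = 0 := by
        by_contra hc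
        exact hN ⟨by simpa [hc] using t4, by simpa [hc] using t5⟩
      exact tern (by simp) rfl rfl he2
  · have hd2 : d2 = 0 := by simpa [hb] using l6
    have he2 : e2 = 0 := by simpa [hb] using l10
    subst hd2 he2
    obtain ⟨-, -, -, h3⟩ := uni (2 * (2 * c2 * a1 * a2 + c2 * a3))
      (2 * (2 * c2 * (2 * a2 * b1 + 2 * a1 * b2) + 2 * c2 * b3 - 2 * c2 * a1 ^ 2))
      (2 * (8 * c2 * b1 * b2 - 8 * c2 * a1 * b1)) (-16 * c2 * b1 ^ 2) (fun y => by
        linear_combination (hj 1 y 0).2.2.2)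
    have hc2 : c2 = 0 := by simpa [hb] using h3
    exact tern (by simp [hc2]) hc2 rfl rfl
end six
end

section
section nrm
variable {K : Type*} [Field K] [IsAlgClosed K] [CharZero K] {V : Submodule K (PP K)}

theorem S4 (hV : Module.finrank K V = 4) (hJ : JJ V)
    {a0 b0 c0 d0 e0 f0 a1 b1 c1 d1 e1 f1 a2 b2 c2 d2 e2 f2 a3 b3 c3 d3 e3 f3 : K}
    (m0 : qq a0 b0 c0 d0 e0 f0 ∈ V) (m1 : X 0 * X 1 + qq a1 b1 c1 d1 e1 f1 ∈ V)
    (m2 : X 0 * X 2 + qq a2 b2 c2 d2 e2 f2 ∈ V) (m3 : X 0 ^ 2 + qq a3 b3 c3 d3 e3 f3 ∈ V)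
    (hn : ¬ (a0 = 0 ∧ b0 = 0 ∧ c0 = 0 ∧ d0 = 0 ∧ e0 = 0 ∧ f0 = 0)) : Good V := by
  have key : ∀ x y z : K, d0 * x + e0 * y + 2 * f0 * z = 0 := fun x y z =>
    (jac_coef (fun w => jac_gen hV hJ m0 m1 m2 m3 hn w x y z)).1
  have hd : d0 = 0 := by simpa using key 1 0 0
  have he : e0 = 0 := by simpa using key 0 1 0
  have hf : f0 = 0 := by simpa using key 0 0 1
  subst hd he hf
  obtain ⟨p, q, r, s, hD, H⟩ := bin a0 b0 c0
  have hg : IsUnit (!![1, 0, 0, 0; 0, p, q, 0; 0, r, s, 0; 0, 0, 0, 1] :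
      Matrix (Fin 4) (Fin 4) K).det := by
    rw [det4, isUnit_iff_ne_zero]; intro h; apply hD; linear_combination h
  have M0 : qq (a0 * p ^ 2 + b0 * p * r + c0 * r ^ 2)
      (2 * a0 * p * q + b0 * (p * s + q * r) + 2 * c0 * r * s)
      (a0 * q ^ 2 + b0 * q * s + c0 * s ^ 2) 0 0 0 ∈
      mp !![1, 0, 0, 0; 0, p, q, 0; 0, r, s, 0; 0, 0, 0, 1] V :=
    memchg m0 (fun x => by simp [mv, qq]; ring)
  have M3 : X 0 ^ 2 + qq (a3 * p ^ 2 + b3 * p * r + c3 * r ^ 2)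
      (2 * a3 * p * q + b3 * (p * s + q * r) + 2 * c3 * r * s)
      (a3 * q ^ 2 + b3 * q * s + c3 * s ^ 2) (d3 * p + e3 * r) (d3 * q + e3 * s) f3 ∈
      mp !![1, 0, 0, 0; 0, p, q, 0; 0, r, s, 0; 0, 0, 0, 1] V :=
    memchg m3 (fun x => by simp [mv, qq]; ring)
  have M1 : X 0 * (C p * X 1 + C q * X 2) + qq (a1 * p ^ 2 + b1 * p * r + c1 * r ^ 2)
      (2 * a1 * p * q + b1 * (p * s + q * r) + 2 * c1 * r * s)
      (a1 * q ^ 2 + b1 * q * s + c1 * s ^ 2) (d1 * p + e1 * r) (d1 * q + e1 * s) f1 ∈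
      mp !![1, 0, 0, 0; 0, p, q, 0; 0, r, s, 0; 0, 0, 0, 1] V :=
    memchg m1 (fun x => by simp [mv, qq]; ring)
  have M2 : X 0 * (C r * X 1 + C s * X 2) + qq (a2 * p ^ 2 + b2 * p * r + c2 * r ^ 2)
      (2 * a2 * p * q + b2 * (p * s + q * r) + 2 * c2 * r * s)
      (a2 * q ^ 2 + b2 * q * s + c2 * s ^ 2) (d2 * p + e2 * r) (d2 * q + e2 * s) f2 ∈
      mp !![1, 0, 0, 0; 0, p, q, 0; 0, r, s, 0; 0, 0, 0, 1] V :=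
    memchg m2 (fun x => by simp [mv, qq]; ring)
  generalize (a1 * p ^ 2 + b1 * p * r + c1 * r ^ 2) = A1 at M1
  generalize (2 * a1 * p * q + b1 * (p * s + q * r) + 2 * c1 * r * s) = B1 at M1
  generalize (a1 * q ^ 2 + b1 * q * s + c1 * s ^ 2) = C1 at M1
  generalize (d1 * p + e1 * r) = D1 at M1
  generalize (d1 * q + e1 * s) = E1 at M1
  generalize (a2 * p ^ 2 + b2 * p * r + c2 * r ^ 2) = A2 at M2
  generalize (2 * a2 * p * q + b2 * (p * s + q * r) + 2 * c2 * r * s) = B2 at M2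
  generalize (a2 * q ^ 2 + b2 * q * s + c2 * s ^ 2) = C2 at M2
  generalize (d2 * p + e2 * r) = D2 at M2
  generalize (d2 * q + e2 * s) = E2 at M2
  generalize (a3 * p ^ 2 + b3 * p * r + c3 * r ^ 2) = A3 at M3
  generalize (2 * a3 * p * q + b3 * (p * s + q * r) + 2 * c3 * r * s) = B3 at M3
  generalize (a3 * q ^ 2 + b3 * q * s + c3 * s ^ 2) = C3 at M3
  generalize (d3 * p + e3 * r) = D3 at M3
  generalize (d3 * q + e3 * s) = E3 at M3
  obtain ⟨Δ, hΔ⟩ : ∃ Δ : K, Δ * (p * s - q * r) = 1 := ⟨_, inv_mul_cancel₀ hD⟩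
  apply Good_of_mp hg
  have hV' := (finrank_mp _ hg V).trans hV
  have hJ' := JJ_mp hg hJ
  generalize mp !![1, 0, 0, 0; 0, p, q, 0; 0, r, s, 0; 0, 0, 0, 1] V = W at *
  rcases H with ⟨h1, h2, h3⟩ | ⟨h1, h2, h3⟩ | ⟨h1, h2, h3⟩
  · rw [h1, h2, h3] at M0
    refine R2 hV' hJ' M0
      (a1 := Δ * (s * A1 - q * A2)) (b1 := Δ * (s * C1 - q * C2)) (c1 := Δ * (s * D1 - q * D2))
      (d1 := Δ * (s * E1 - q * E2)) (e1 := Δ * (s * f1 - q * f2))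
      (a2 := Δ * (p * A2 - r * A1)) (b2 := Δ * (p * C2 - r * C1)) (c2 := Δ * (p * D2 - r * D1))
      (d2 := Δ * (p * E2 - r * E1)) (e2 := Δ * (p * f2 - r * f1))
      (a3 := A3) (b3 := C3) (c3 := D3) (d3 := E3) (e3 := f3)
      (mem4' M0 M1 M2 M3 (-(Δ * (s * B1 - q * B2))) (Δ * s) (-(Δ * q)) 0 fun x => ?_)
      (mem4' M0 M1 M2 M3 (-(Δ * (p * B2 - r * B1))) (-(Δ * r)) (Δ * p) 0 fun x => ?_)
      (mem4' M0 M1 M2 M3 (-B3) 0 0 1 fun x => ?_)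
    · simp [qq]; linear_combination (-x 0 * x 1) * hΔ
    · simp [qq]; linear_combination (-x 0 * x 2) * hΔ
    · simp [qq]; ring
  · rw [h1, h2, h3] at M0
    refine R1 hV' hJ' M0
      (a1 := Δ * (s * B1 - q * B2)) (b1 := Δ * (s * C1 - q * C2)) (c1 := Δ * (s * D1 - q * D2))
      (d1 := Δ * (s * E1 - q * E2)) (e1 := Δ * (s * f1 - q * f2))
      (a2 := Δ * (p * B2 - r * B1)) (b2 := Δ * (p * C2 - r * C1)) (c2 := Δ * (p * D2 - r * D1))
      (d2 := Δ * (p * E2 - r * E1)) (e2 := Δ * (p * f2 - r * f1))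
      (a3 := B3) (b3 := C3) (c3 := D3) (d3 := E3) (e3 := f3)
      (mem4' M0 M1 M2 M3 (-(Δ * (s * A1 - q * A2))) (Δ * s) (-(Δ * q)) 0 fun x => ?_)
      (mem4' M0 M1 M2 M3 (-(Δ * (p * A2 - r * A1))) (-(Δ * r)) (Δ * p) 0 fun x => ?_)
      (mem4' M0 M1 M2 M3 (-A3) 0 0 1 fun x => ?_)
    · simp [qq]; linear_combination (-x 0 * x 1) * hΔ
    · simp [qq]; linear_combination (-x 0 * x 2) * hΔ
    · simp [qq]; ring
  · exact absurd ⟨h1, h2, h3, rfl, rfl, rfl⟩ hn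

theorem chqq (β δ γ a b c d e f : K) (x : Fin 4 → K) :
    eval (mv !![1, 0, 0, -γ / 2; 0, 1, 0, -β; 0, 0, 1, -δ; 0, 0, 0, 1] x) (qq a b c d e f) =
    eval x (qq a b c (d - 2 * a * β - b * δ) (e - b * β - 2 * c * δ)
      (f + a * β ^ 2 + b * β * δ + c * δ ^ 2 - d * β - e * δ)) := by
  simp [mv, qq]; ring

theorem S3' (hV : Module.finrank K V = 4) (hJ : JJ V) {β δ γ : K}
    {a0 b0 c0 d0 e0 f0 a1 b1 c1 d1 e1 f1 a2 b2 c2 d2 e2 f2 a3 b3 c3 d3 e3 f3 : K}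
    (m0 : qq a0 b0 c0 d0 e0 f0 ∈ V)
    (m1 : X 0 * X 1 + C β * (X 0 * X 3) + qq a1 b1 c1 d1 e1 f1 ∈ V)
    (m2 : X 0 * X 2 + C δ * (X 0 * X 3) + qq a2 b2 c2 d2 e2 f2 ∈ V)
    (m3 : X 0 ^ 2 + C γ * (X 0 * X 3) + qq a3 b3 c3 d3 e3 f3 ∈ V)
    (hn : ¬ (a0 = 0 ∧ b0 = 0 ∧ c0 = 0 ∧ d0 = 0 ∧ e0 = 0 ∧ f0 = 0)) : Good V := by
  have hg : IsUnit (!![1, 0, 0, -γ / 2; 0, 1, 0, -β; 0, 0, 1, -δ; 0, 0, 0, 1] :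
      Matrix (Fin 4) (Fin 4) K).det := by
    rw [det4]; simp
  apply Good_of_mp hg
  refine S4 ((finrank_mp _ hg V).trans hV) (JJ_mp hg hJ) 
    (memchg m0 (fun x => (chqq _ _ _ _ _ _ _ _ _ x).symm))
    (a1 := a1) (b1 := b1) (c1 := c1) (d1 := d1 - 2 * a1 * β - b1 * δ - γ / 2)
    (e1 := e1 - b1 * β - 2 * c1 * δ) 
    (f1 := f1 + a1 * β ^ 2 + b1 * β * δ + c1 * δ ^ 2 - d1 * β - e1 * δ) 
    (a2 := a2) (b2 := b2) (c2 := c2) (d2 := d2 - 2 * a2 * β - b2 * δ)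
    (e2 := e2 - b2 * β - 2 * c2 * δ - γ / 2)
    (f2 := f2 + a2 * β ^ 2 + b2 * β * δ + c2 * δ ^ 2 - d2 * β - e2 * δ) 
    (a3 := a3) (b3 := b3) (c3 := c3) (d3 := d3 - 2 * a3 * β - b3 * δ)
    (e3 := e3 - b3 * β - 2 * c3 * δ)
    (f3 := f3 + a3 * β ^ 2 + b3 * β * δ + c3 * δ ^ 2 - d3 * β - e3 * δ - γ ^ 2 / 4)
    (memchg m1 (fun x => ?_))
    (memchg m2 (fun x => ?_))
    (memchg m3 (fun x => ?_)) ?_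
  · rw [map_add (eval (mv _ x)), chqq]; simp [mv, qq]; ring
  · rw [map_add (eval (mv _ x)), chqq]; simp [mv, qq]; ring
  · rw [map_add (eval (mv _ x)), chqq]; simp [mv, qq]; ring
  · rintro ⟨rfl, rfl, rfl, h1, h2, h3⟩
    simp at h1 h2
    subst h1 h2
    simp at h3
    exact hn (by simp [h3])

theorem S3 (hV : Module.finrank K V = 4) (hJ : JJ V) {t0 t1 t2 t3 s1 s2 s3 r2 r3 : K}
    {a0 b0 c0 d0 e0 f0 a1 b1 c1 d1 e1 f1 a2 b2 c2 d2 e2 f2 a3 b3 c3 d3 e3 f3 : K}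
    (m0 : qq a0 b0 c0 d0 e0 f0 ∈ V)
    (m1 : C s1 * (X 0 * X 1) + C s2 * (X 0 * X 2) + C s3 * (X 0 * X 3) + qq a1 b1 c1 d1 e1 f1 ∈ V)
    (m2 : C r2 * (X 0 * X 2) + C r3 * (X 0 * X 3) + qq a2 b2 c2 d2 e2 f2 ∈ V)
    (m3 : C t0 * X 0 ^ 2 + C t1 * (X 0 * X 1) + C t2 * (X 0 * X 2) + C t3 * (X 0 * X 3)
      + qq a3 b3 c3 d3 e3 f3 ∈ V)
    (ht : t0 ≠ 0) (hs : s1 ≠ 0) (hr : r2 ≠ 0)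
    (hn : ¬ (a0 = 0 ∧ b0 = 0 ∧ c0 = 0 ∧ d0 = 0 ∧ e0 = 0 ∧ f0 = 0)) : Good V := by
  obtain ⟨t, ht⟩ : ∃ t : K, t * t0 = 1 := ⟨_, inv_mul_cancel₀ ht⟩
  obtain ⟨s, hs⟩ : ∃ t : K, t * s1 = 1 := ⟨_, inv_mul_cancel₀ hs⟩
  obtain ⟨r, hr⟩ : ∃ t : K, t * r2 = 1 := ⟨_, inv_mul_cancel₀ hr⟩
  have M2 : X 0 * X 2 + C (r * r3) * (X 0 * X 3) +
      qq (r * a2) (r * b2) (r * c2) (r * d2) (r * e2) (r * f2) ∈ V :=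
    mem4' m0 m1 m2 m3 0 0 r 0 (fun x => by simp [qq]; linear_combination (-x 0 * x 2) * hr)
  have M1 : X 0 * X 1 + C (s * (s3 - s2 * (r * r3))) * (X 0 * X 3) +
      qq (s * (a1 - s2 * (r * a2))) (s * (b1 - s2 * (r * b2))) (s * (c1 - s2 * (r * c2)))
        (s * (d1 - s2 * (r * d2))) (s * (e1 - s2 * (r * e2))) (s * (f1 - s2 * (r * f2))) ∈ V :=
    mem4' m0 m1 M2 m3 0 s (-(s * s2)) 0
      (fun x => by simp [qq]; linear_combination (-x 0 * x 1) * hs)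
  generalize (s * (a1 - s2 * (r * a2))) = A1 at M1
  generalize (s * (b1 - s2 * (r * b2))) = B1 at M1
  generalize (s * (c1 - s2 * (r * c2))) = C1 at M1
  generalize (s * (d1 - s2 * (r * d2))) = D1 at M1
  generalize (s * (e1 - s2 * (r * e2))) = E1 at M1
  generalize (s * (f1 - s2 * (r * f2))) = F1 at M1
  generalize (s * (s3 - s2 * (r * r3))) = β at M1
  refine S3' hV hJ m0 M1 M2 (γ := t * (t3 - t1 * β - t2 * (r * r3)))
    (a3 := t * (a3 - t1 * A1 - t2 * (r * a2))) (b3 := t * (b3 - t1 * B1 - t2 * (r * b2)))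
    (c3 := t * (c3 - t1 * C1 - t2 * (r * c2))) (d3 := t * (d3 - t1 * D1 - t2 * (r * d2)))
    (e3 := t * (e3 - t1 * E1 - t2 * (r * e2))) (f3 := t * (f3 - t1 * F1 - t2 * (r * f2)))
    (mem4' m0 M1 M2 m3 0 (-(t * t1)) (-(t * t2)) t (fun x => ?_)) hn
  simp [qq]; linear_combination (-(x 0) ^ 2) * ht
end nrm
end

section
section fin
variable {K : Type*} [Field K]

theorem hc2 (a p : PP K) (hp : p.IsHomogeneous 2) :
    homogeneousComponent 2 (a * p) = coeff 0 a • p := by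
  induction a using MvPolynomial.induction_on' with
  | monomial m r =>
    have h : (monomial m r * p).IsHomogeneous (m.degree + 2) :=
      (isHomogeneous_monomial r rfl).mul hp
    rw [homogeneousComponent_of_mem h, coeff_monomial]
    by_cases hm : m = 0
    · subst hm
      simp [smul_eq_C_mul]
    · have : m.degree ≠ 0 := by
        rwa [Ne, Finsupp.degree_eq_zero_iff]
      rw [if_neg (by omega), if_neg hm, zero_smul]
  | add a b ha hb => rw [add_mul, map_add, ha, hb, coeff_add, add_smul]

theorem quadPart_eq (qs : Fin 4 → PP K) (hq : ∀ k, (qs k).IsHomogeneous 2) :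
    quadPart (Ideal.span (Set.range qs)) = Submodule.span K (Set.range qs) := by
  apply le_antisymm
  · rintro q ⟨h1, h2⟩
    have h1' : q ∈ Ideal.span (Set.range qs) := h1
    rw [Ideal.mem_span_range_iff_exists_fun] at h1'
    obtain ⟨a, ha⟩ := h1'
    rw [Submodule.mem_span_range_iff_exists_fun]
    refine ⟨fun i => coeff 0 (a i), ?_⟩
    have := congrArg (homogeneousComponent 2) ha
    rw [homogeneousComponent_of_mem h2, if_pos rfl, map_sum] at this
    rw [← this]
    exact Finset.sum_congr rfl fun i _ => (hc2 _ _ (hq i)).symm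
  · rw [Submodule.span_le]
    rintro _ ⟨i, rfl⟩
    exact ⟨Ideal.subset_span ⟨i, rfl⟩, hq i⟩

theorem hom_ind {P : PP K → Prop} (hX : ∀ i j, P (X i * X j)) (hadd : ∀ p q, P p → P q → P (p + q))
    (h0 : P 0) (hsm : ∀ (a : K) p, P p → P (a • p)) (q : PP K) (hq : q.IsHomogeneous 2) : P q := by
  have : q ∈ homogeneousSubmodule (Fin 4) K 2 := hq
  rw [← homogeneousSubmodule_one_pow, homogeneousSubmodule_one_eq_span_X, pow_two,
    Submodule.span_mul_span] at this
  clear hq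
  induction this using Submodule.span_induction with
  | mem x h =>
    obtain ⟨_, ⟨i, rfl⟩, _, ⟨j, rfl⟩, rfl⟩ := h
    exact hX i j
  | zero => exact h0
  | add x y _ _ hx hy => exact hadd _ _ hx hy
  | smul a x _ hx => exact hsm a x hx


theorem cmon {i j k l : Fin 4} : coeff (Finsupp.single i 1 + Finsupp.single j 1) (X k * X l : PP K) =
    if (k = i ∧ l = j) ∨ (k = j ∧ l = i) then 1 else 0 := by
  have : (X k * X l : PP K) = monomial (Finsupp.single k 1 + Finsupp.single l 1) 1 := by
    simp [X, monomial_mul]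
  rw [this, coeff_monomial]
  congr 1
  rw [Finsupp.ext_iff]
  simp only [Finsupp.add_apply, Finsupp.single_apply]
  clear this
  rw [eq_iff_iff]
  revert i j k l
  decide

abbrev ee (i j : Fin 4) : Fin 4 →₀ ℕ := Finsupp.single i 1 + Finsupp.single j 1

theorem ee_self (i : Fin 4) : ee i i = Finsupp.single i 2 := by
  rw [ee, ← Finsupp.single_add]

theorem ff (q : PP K) (hq : q.IsHomogeneous 2) :
    q = C (coeff (ee 0 0) q) * X 0 ^ 2 + C (coeff (ee 0 1) q) * (X 0 * X 1) +
      C (coeff (ee 0 2) q) * (X 0 * X 2) + C (coeff (ee 0 3) q) * (X 0 * X 3) +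
      qq (coeff (ee 1 1) q) (coeff (ee 1 2) q) (coeff (ee 2 2) q) (coeff (ee 1 3) q)
        (coeff (ee 2 3) q) (coeff (ee 3 3) q) := by
  refine hom_ind (P := fun q => q = C (coeff (ee 0 0) q) * X 0 ^ 2 + C (coeff (ee 0 1) q) * (X 0 * X 1) +
      C (coeff (ee 0 2) q) * (X 0 * X 2) + C (coeff (ee 0 3) q) * (X 0 * X 3) +
      qq (coeff (ee 1 1) q) (coeff (ee 1 2) q) (coeff (ee 2 2) q) (coeff (ee 1 3) q)
        (coeff (ee 2 3) q) (coeff (ee 3 3) q)) ?_ ?_ ?_ ?_ q hq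
  · intro i j
    simp only [cmon]
    fin_cases i <;> fin_cases j <;> simp [qq] <;> ring
  · intro p q hp hq
    conv_lhs => rw [hp, hq]
    simp only [qq, coeff_add, map_add]
    ring
  · simp [qq]
  · intro a p hp
    conv_lhs => rw [hp]
    simp only [qq, smul_eq_C_mul, coeff_C_mul, map_mul]
    ring

theorem chg_hom {g : Matrix (Fin 4) (Fin 4) K} {q : PP K} (hq : q.IsHomogeneous 2) :
    (chg g q).IsHomogeneous 2 := by
  have := hq.aeval (n := 1) (fun i : Fin 4 => ∑ j : Fin 4, g i j • (X j : PP K)) (fun i =>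
    Submodule.sum_mem (homogeneousSubmodule (Fin 4) K 1) fun j _ =>
      Submodule.smul_mem _ _ (isHomogeneous_X K j))
  exact this

theorem lt1 : lexLT (ee 0 1) (ee 0 0) := ⟨0, by simp, by simp [Finsupp.single_apply]⟩
theorem lt2 : lexLT (ee 0 2) (ee 0 0) := ⟨0, by simp, by simp [Finsupp.single_apply]⟩
theorem lt3 : lexLT (ee 0 2) (ee 0 1) :=
  ⟨1, by simp [Fin.forall_fin_succ, Finsupp.single_apply], by simp [Finsupp.single_apply]⟩
theorem lt4 : lexLT (ee 1 1) (ee 0 0) := ⟨0, by simp, by simp [Finsupp.single_apply]⟩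
theorem lt5 : lexLT (ee 1 1) (ee 0 1) := ⟨0, by simp, by simp [Finsupp.single_apply]⟩
theorem lt6 : lexLT (ee 1 1) (ee 0 2) := ⟨0, by simp, by simp [Finsupp.single_apply]⟩
theorem lt7 : lexLT (ee 1 1) (ee 0 3) := ⟨0, by simp, by simp [Finsupp.single_apply]⟩

theorem lead0 {q : PP K} (hq : q.IsHomogeneous 2) (h : leadIs q (ee 1 1)) :
    ∃ a b c d e f : K, a ≠ 0 ∧ q = qq a b c d e f := by
  have := ff q hq
  rw [h.2 _ lt4, h.2 _ lt5, h.2 _ lt6, h.2 _ lt7] at this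
  exact ⟨_, _, _, _, _, _, h.1, by simpa using this⟩

theorem lead1 {q : PP K} (hq : q.IsHomogeneous 2) (h : leadIs q (ee 0 1)) :
    ∃ s1 s2 s3 a b c d e f : K, s1 ≠ 0 ∧
      q = C s1 * (X 0 * X 1) + C s2 * (X 0 * X 2) + C s3 * (X 0 * X 3) + qq a b c d e f := by
  have := ff q hq
  rw [h.2 _ lt1] at this
  exact ⟨_, _, _, _, _, _, _, _, _, h.1, by simpa using this⟩

theorem lead2 {q : PP K} (hq : q.IsHomogeneous 2) (h : leadIs q (ee 0 2)) :
    ∃ s2 s3 a b c d e f : K, s2 ≠ 0 ∧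
      q = C s2 * (X 0 * X 2) + C s3 * (X 0 * X 3) + qq a b c d e f := by
  have := ff q hq
  rw [h.2 _ lt2, h.2 _ lt3] at this
  exact ⟨_, _, _, _, _, _, _, _, h.1, by simpa using this⟩

theorem lead3 {q : PP K} (hq : q.IsHomogeneous 2) (h : leadIs q (ee 0 0)) :
    ∃ s0 s1 s2 s3 a b c d e f : K, s0 ≠ 0 ∧
      q = C s0 * X 0 ^ 2 + C s1 * (X 0 * X 1) + C s2 * (X 0 * X 2) + C s3 * (X 0 * X 3)
        + qq a b c d e f :=
  ⟨_, _, _, _, _, _, _, _, _, _, h.1, ff q hq⟩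

theorem sing0 {g : Matrix (Fin 4) (Fin 4) K} (hg : IsUnit g.det) {q : PP K}
    (hq : q.IsHomogeneous 2) (h : leadIs (chg g q) (ee 1 1)) : sing (fun i => g i 0) q := by
  obtain ⟨a, b, c, d, e, f, _, h1⟩ := lead0 (chg_hom hq) h
  have h2 : sing (g⁻¹.mulVec (fun i => g i 0)) (chg g q) := by
    have : g⁻¹.mulVec (fun i => g i 0) = fun i => (1 : Matrix (Fin 4) (Fin 4) K) i 0 := by
      rw [← Matrix.nonsing_inv_mul g hg]; rfl
    rw [this, h1]
    intro i
    fin_cases i <;> simp [qq, pderiv_X]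
  have h3 := sing_chg h2
  rwa [chg_inv g hg] at h3

theorem jac_zero [Infinite K] (qs : Fin 4 → PP K) (hq : ∀ k, (qs k).IsHomogeneous 2)
    (c : MvPolynomial (Fin 4 × Fin 4) K) (hc : c ≠ 0)
    (H : ∀ g : Matrix (Fin 4) (Fin 4) K, eval (fun ij : Fin 4 × Fin 4 => g ij.1 ij.2) c ≠ 0 →
      ∃ q ∈ Submodule.span K (Set.range qs), leadIs (chg g q) (ee 1 1)) :
    (Matrix.of fun k i => pderiv i (qs k)).det = 0 := by
  have hsp : ∀ q ∈ Submodule.span K (Set.range qs), q.IsHomogeneous 2 := by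
    have : Submodule.span K (Set.range qs) ≤ homogeneousSubmodule (Fin 4) K 2 := by
      rw [Submodule.span_le]; rintro _ ⟨i, rfl⟩; exact hq i
    exact fun q h => this h
  have F : c * (Matrix.mvPolynomialX (Fin 4) (Fin 4) K).det *
      rename (fun i : Fin 4 => (i, (0 : Fin 4))) (Matrix.of fun k i => pderiv i (qs k)).det = 0 := by
    apply MvPolynomial.funext
    intro x
    rw [map_mul, map_mul, map_zero]
    by_cases h1 : eval x c = 0
    · simp [h1]
    by_cases h2 : eval x (Matrix.mvPolynomialX (Fin 4) (Fin 4) K).det = 0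
    · simp [h2]
    apply mul_eq_zero_of_right
    have h2' : IsUnit (Matrix.of fun i j => x (i, j)).det := by
      rw [isUnit_iff_ne_zero]
      convert h2
      rw [RingHom.map_det]
      congr 1
      ext i j
      simp
    obtain ⟨q, hqs, hl⟩ := H (Matrix.of fun i j => x (i, j)) h1
    have hs := sing0 h2' (hsp q hqs) hl
    have h0 : q ≠ 0 := by rintro rfl; exact hl.1 (by simp)
    rw [eval_rename, RingHom.map_det, ← Matrix.exists_vecMul_eq_zero_iff]
    rw [Submodule.mem_span_range_iff_exists_fun] at hqs
    obtain ⟨c, rfl⟩ := hqs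
    refine ⟨c, ?_, ?_⟩
    · rintro rfl; simp at h0
    · ext i
      have := hs i
      simp only [map_sum, Derivation.map_smul, smul_eval] at this
      simpa [Matrix.vecMul, dotProduct, Function.comp_def] using this
  rw [mul_eq_zero, mul_eq_zero] at F
  rcases F with (F | F) | F
  · exact absurd F hc
  · exact absurd F (Matrix.det_mvPolynomialX_ne_zero _ _)
  · refine rename_injective _ ?_ (F.trans (map_zero _).symm)
    intro a b h
    simpa using h

theorem JJ_of_jac (qs : Fin 4 → PP K) (hli : LinearIndependent K qs)
    (H : (Matrix.of fun k i => pderiv i (qs k)).det = 0) :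
    JJ (Submodule.span K (Set.range qs)) := by
  intro p
  have h := congrArg (eval p) H
  rw [RingHom.map_det, map_zero, ← Matrix.exists_vecMul_eq_zero_iff] at h
  obtain ⟨v, hv, h⟩ := h
  refine ⟨∑ i, v i • qs i, ?_, ?_, ?_⟩
  · exact Submodule.sum_mem _ fun i _ => Submodule.smul_mem _ _ (Submodule.subset_span ⟨i, rfl⟩)
  · intro h0
    exact hv (funext (Fintype.linearIndependent_iff.1 hli v h0))
  · intro i
    have := congrFun h i
    simp only [map_sum, Derivation.map_smul, smul_eval]
    simpa [Matrix.vecMul, dotProduct] using this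

theorem good_main [IsAlgClosed K] [CharZero K] (qs : Fin 4 → PP K)
    (hq : ∀ k, (qs k).IsHomogeneous 2) (hli : LinearIndependent K qs)
    (c : MvPolynomial (Fin 4 × Fin 4) K) (hc : c ≠ 0)
    (H : ∀ g : Matrix (Fin 4) (Fin 4) K, eval (fun ij : Fin 4 × Fin 4 => g ij.1 ij.2) c ≠ 0 →
      ∀ m ∈ ({ee 0 0, ee 0 1, ee 0 2, ee 1 1} : Set (Fin 4 →₀ ℕ)),
      ∃ q ∈ Submodule.span K (Set.range qs), leadIs (chg g q) m) :
    Module.finrank K (Submodule.span K (Set.range qs)) = 4 ∧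
    Good (Submodule.span K (Set.range qs)) := by
  have hV : Module.finrank K (Submodule.span K (Set.range qs)) = 4 := by
    rw [finrank_span_eq_card hli]; simp
  refine ⟨hV, ?_⟩
  have hJ := JJ_of_jac qs hli (jac_zero qs hq c hc fun g hg => H g hg _ (by simp))
  have hsp : ∀ q ∈ Submodule.span K (Set.range qs), q.IsHomogeneous 2 := by
    have : Submodule.span K (Set.range qs) ≤ homogeneousSubmodule (Fin 4) K 2 := by
      rw [Submodule.span_le]; rintro _ ⟨i, rfl⟩; exact hq i
    exact fun q h => this h
  obtain ⟨x, hx⟩ : ∃ x, eval x (c * (Matrix.mvPolynomialX (Fin 4) (Fin 4) K).det) ≠ 0 := by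
    by_contra! h
    exact mul_ne_zero hc (Matrix.det_mvPolynomialX_ne_zero (Fin 4) K)
      (MvPolynomial.funext fun x => (h x).trans (map_zero _).symm)
  rw [map_mul, mul_ne_zero_iff] at hx
  have hg : IsUnit (Matrix.of fun i j => x (i, j)).det := by
    rw [isUnit_iff_ne_zero]
    convert hx.2
    rw [RingHom.map_det]
    congr 1
    ext i j
    simp
  have H' := H (Matrix.of fun i j => x (i, j)) hx.1
  generalize (Matrix.of fun i j => x (i, j) : Matrix (Fin 4) (Fin 4) K) = g at H' hg
  obtain ⟨q0, k0, l0⟩ := H' (ee 1 1) (by simp)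
  obtain ⟨q1, k1, l1⟩ := H' (ee 0 1) (by simp)
  obtain ⟨q2, k2, l2⟩ := H' (ee 0 2) (by simp)
  obtain ⟨q3, k3, l3⟩ := H' (ee 0 0) (by simp)
  apply Good_of_mp hg
  obtain ⟨_, _, _, _, _, _, n0, w0⟩ := lead0 (chg_hom (hsp _ k0)) l0
  obtain ⟨_, _, _, _, _, _, _, _, _, n1, w1⟩ := lead1 (chg_hom (hsp _ k1)) l1
  obtain ⟨_, _, _, _, _, _, _, _, n2, w2⟩ := lead2 (chg_hom (hsp _ k2)) l2
  obtain ⟨_, _, _, _, _, _, _, _, _, _, n3, w3⟩ := lead3 (chg_hom (hsp _ k3)) l3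
  have k0' := mem_mp (g := g) k0
  have k1' := mem_mp (g := g) k1
  have k2' := mem_mp (g := g) k2
  have k3' := mem_mp (g := g) k3
  rw [w0] at k0'
  rw [w1] at k1'
  rw [w2] at k2'
  rw [w3] at k3'
  exact S3 ((finrank_mp _ hg _).trans hV) (JJ_mp hg hJ) k0' k1' k2' k3' n3 n1 n2
    (fun h => n0 h.1)
end fin
end

/-- Classification: if `I ⊂ K[x₁,…,x₄]` is minimally generated by four quadrics and
its generic initial ideal with respect to the lexicographic order contains
`x₁², x₁x₂, x₁x₃, x₂²`, then up to a linear change of coordinates `[I]₂` is one of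
the explicitly listed spaces (i)–(x).  Genericity is expressed by a nonzero
polynomial condition on the entries of the change-of-coordinates matrix. -/
theorem quadric_classification {K : Type*} [Field K] [IsAlgClosed K] [CharZero K]
    (I : Ideal (MvPolynomial (Fin 4) K))
    (hmin : ∃ qs : Fin 4 → MvPolynomial (Fin 4) K,
      (∀ k : Fin 4, (qs k).IsHomogeneous 2) ∧ LinearIndependent K qs ∧
        I = Ideal.span (Set.range qs))
    (hgin : ∃ c : MvPolynomial (Fin 4 × Fin 4) K, c ≠ 0 ∧
      ∀ g : Matrix (Fin 4) (Fin 4) K,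
        MvPolynomial.eval (fun ij : Fin 4 × Fin 4 => g ij.1 ij.2) c ≠ 0 →
        ∀ m ∈ ({Finsupp.single 0 2,
                Finsupp.single 0 1 + Finsupp.single 1 1,
                Finsupp.single 0 1 + Finsupp.single 2 1,
                Finsupp.single 1 2} : Set (Fin 4 →₀ ℕ)),
          ∃ q ∈ quadPart I, leadIs (chg g q) m) :
    ∃ g : Matrix (Fin 4) (Fin 4) K, IsUnit g.det ∧
      (Submodule.map (chg g).toLinearMap (quadPart I) =
          Submodule.span K {X 0 * X 2, X 0 * X 3, X 1 * X 2, X 1 * X 3} ∨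
       Submodule.map (chg g).toLinearMap (quadPart I) =
          Submodule.span K {X 0 ^ 2, X 1 ^ 2, X 2 ^ 2, X 0 * X 1 + X 0 * X 2 + X 1 * X 2} ∨
       Submodule.map (chg g).toLinearMap (quadPart I) =
          Submodule.span K {X 0 ^ 2, X 1 ^ 2, X 2 ^ 2, X 0 * X 2 + X 1 * X 2} ∨
       Submodule.map (chg g).toLinearMap (quadPart I) =
          Submodule.span K {X 0 ^ 2, X 0 * X 1, X 0 * X 2 - X 1 ^ 2, X 2 ^ 2} ∨
       Submodule.map (chg g).toLinearMap (quadPart I) =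
          Submodule.span K {X 0 ^ 2, X 0 * X 1, X 0 * X 2 - X 1 ^ 2, X 1 * X 2} ∨
       Submodule.map (chg g).toLinearMap (quadPart I) =
          Submodule.span K {X 0 ^ 2, X 0 * X 2, X 1 ^ 2, X 1 * X 2} ∨
       Submodule.map (chg g).toLinearMap (quadPart I) =
          Submodule.span K {X 0 ^ 2, X 0 * X 1, X 0 * X 2, X 1 * X 2} ∨
       Submodule.map (chg g).toLinearMap (quadPart I) =
          Submodule.span K {X 0 ^ 2, X 0 * X 1, X 1 ^ 2, X 2 * X 3} ∨
       Submodule.map (chg g).toLinearMap (quadPart I) =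
          Submodule.span K {X 0 ^ 2, X 0 * X 1, X 1 ^ 2, X 2 ^ 2 + X 1 * X 3} ∨
       Submodule.map (chg g).toLinearMap (quadPart I) =
          Submodule.span K {X 0 ^ 2, X 0 * X 1, X 1 ^ 2, X 2 ^ 2} ∨
       Submodule.map (chg g).toLinearMap (quadPart I) =
          Submodule.span K {X 0 ^ 2, X 0 * X 1, X 1 ^ 2, X 0 * X 3 - X 1 * X 2} ∨
       Submodule.map (chg g).toLinearMap (quadPart I) =
          Submodule.span K {X 0 ^ 2, X 0 * X 1, X 1 ^ 2, X 0 * X 2}) := by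
  obtain ⟨qs, hq, hli, rfl⟩ := hmin
  obtain ⟨c, hc, H⟩ := hgin
  rw [quadPart_eq qs hq] at *
  have e : ∀ i : Fin 4, Finsupp.single i 2 = ee i i := fun i => (ee_self i).symm
  rw [e, e] at H
  obtain ⟨hV, hG⟩ := good_main qs hq hli c hc H
  exact Good_final hV hG

end
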